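/- arXiv:2210.05212 — 2 statements merged into one kernel-verified Lean document; each statement's English description precedes it below -/
import Mathlib

section
/- Let (σ_k)_{k∈ℕ} be any sequence of positive reals with σ_k → ∞ as k → ∞. For each k, let the weights a_1, …, a_k be i.i.d. Gaussian N(0, σ_k²/k) and the biases b_1, …, b_k be i.i.d. Uniform[0,1] independent of the weights. Then the probability that the RNN step map f_{a,b} is Li-Yorke chaotic tends to 1 as k → ∞. -/
open MeasureTheory ProbabilityTheory Filter Set
open scoped NNReal ENNReal

/-- Clip a real number to the interval `[0,1]`. -/
noncomputable def clip (y : ℝ) : ℝ := min (max y 0) 1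

/-- The RNN step map `f_{a,b}(x) = clip (∑ i, a i * ReLU (x - b i))`. -/
noncomputable def rnnStep {k : ℕ} (a b : Fin k → ℝ) (x : ℝ) : ℝ :=
  clip (∑ i, a i * max (x - b i) 0)

/-- `f` is Li-Yorke chaotic on `[0,1]`: there is an uncountable scrambled set. -/
def LiYorkeChaotic (f : ℝ → ℝ) : Prop :=
  ∃ S : Set ℝ, S ⊆ Set.Icc 0 1 ∧ ¬ S.Countable ∧
    ∀ x ∈ S, ∀ y ∈ S, x ≠ y →
      Filter.liminf (fun n => |f^[n] x - f^[n] y|) Filter.atTop = 0 ∧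
      0 < Filter.limsup (fun n => |f^[n] x - f^[n] y|) Filter.atTop

/-- The joint law of `k` i.i.d. `N(0, v)` weights and `k` i.i.d. `Uniform[0,1]`
biases, independent of each other. -/
noncomputable def rnnMeasure (k : ℕ) (v : ℝ≥0) :
    Measure ((Fin k → ℝ) × (Fin k → ℝ)) :=
  (Measure.pi fun _ => gaussianReal 0 v).prod
    (Measure.pi fun _ => volume.restrict (Set.Icc (0:ℝ) 1))

/-- If compact sets `I 0, I 1, …` satisfy `I (n + 1) ⊆ f '' I n`, some orbit follows them. -/
theorem exists_forall_iterate_mem {f : ℝ → ℝ} (hf : Continuous f) (I : ℕ → Set ℝ)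
    (hc : ∀ n, IsCompact (I n)) (hne : ∀ n, (I n).Nonempty)
    (hcov : ∀ n, I (n + 1) ⊆ f '' I n) :
    ∃ x, ∀ n, f^[n] x ∈ I n := by
  have hreach : ∀ n, ∀ y ∈ I n, ∃ x, f^[n] x = y ∧ ∀ j ≤ n, f^[j] x ∈ I j := by
    intro n
    induction n with
    | zero => intro y hy; exact ⟨y, rfl, fun j hj => by simpa [Nat.le_zero.1 hj] using hy⟩
    | succ n ih =>
      intro y hy
      obtain ⟨y', hy', rfl⟩ := hcov n hy
      obtain ⟨x, hx, hj⟩ := ih y' hy'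
      refine ⟨x, by rw [Function.iterate_succ_apply', hx], fun j hjn => ?_⟩
      rcases Nat.lt_or_ge j (n + 1) with h | h
      · exact hj j (by omega)
      · obtain rfl : j = n + 1 := by omega
        rwa [Function.iterate_succ_apply', hx]
  let C : ℕ → Set ℝ := fun n => ⋂ j ∈ Finset.range (n + 1), f^[j] ⁻¹' I j
  have hclosed : ∀ n, IsClosed (C n) := fun n =>
    isClosed_biInter fun j _ => (hc j).isClosed.preimage (hf.iterate j)
  have hmem : ∀ n x, x ∈ C n ↔ ∀ j ≤ n, f^[j] x ∈ I j := by
    intro n x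
    simp [C]
  obtain ⟨x, hx⟩ := IsCompact.nonempty_iInter_of_sequence_nonempty_isCompact_isClosed C
    (fun n x hx => (hmem n x).2 fun j hj => (hmem (n + 1) x).1 hx j (by omega))
    (fun n => by
      obtain ⟨y, hy⟩ := hne n
      obtain ⟨x, -, hx⟩ := hreach n y hy
      exact ⟨x, (hmem n x).2 hx⟩)
    ((hc 0).of_isClosed_subset (hclosed 0) fun x hx => (hmem 0 x).1 hx 0 le_rfl) hclosed
  exact ⟨x, fun n => (hmem n x).1 (mem_iInter.1 hx n) n le_rfl⟩

/-- Transition rule of the automaton that visits levels `n, n - 1, …, 0` for `n = 0, 1, 2, …`. -/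
def excursionStep : ℕ × ℕ → ℕ × ℕ
  | (n, 0) => (n + 1, n + 1)
  | (n, r + 1) => (n, r)

theorem excursionStep_iterate (n r : ℕ) : excursionStep^[r] (n, r) = (n, 0) := by
  induction r with
  | zero => rfl
  | succ r ih => rw [Function.iterate_succ_apply]; exact ih

theorem exists_excursionStep_iterate_eq (n : ℕ) :
    ∃ t, n ≤ t ∧ excursionStep^[t] (0, 0) = (n, 0) := by
  induction n with
  | zero => exact ⟨0, le_rfl, rfl⟩
  | succ n ih =>
    obtain ⟨t, ht, h⟩ := ih
    refine ⟨(n + 1) + (t + 1), by omega, ?_⟩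
    rw [Function.iterate_add_apply, Function.iterate_succ_apply' _ t, h]
    exact excursionStep_iterate (n + 1) (n + 1)

theorem exists_excursionStep_iterate_top (n : ℕ) :
    ∃ t, n ≤ t ∧ excursionStep^[t] (0, 0) = (n + 1, n + 1) := by
  obtain ⟨t, ht, h⟩ := exists_excursionStep_iterate_eq n
  exact ⟨t + 1, by omega, by rw [Function.iterate_succ_apply', h]; rfl⟩

/-- The set prescribed by the symbols `ω` in a given state of the automaton. -/
def excursionSet (L : ℕ → Set ℝ) (K : Set ℝ) (ω : ℕ → Bool) : ℕ × ℕ → Set ℝ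
  | (n, 0) => if ω n then K else L 0
  | (_, r + 1) => L r

/-- A map with a set `K` and shrinking sets `L n`, with `L 0` at a positive distance from `K`,
such that `L 0` and `K` cover everything and `L (n + 1)` covers `L n`, is Li-Yorke chaotic. -/
theorem liYorkeChaotic_of_covering {f : ℝ → ℝ} (hf : Continuous f) (L : ℕ → Set ℝ) (K : Set ℝ)
    (hL : ∀ n, IsCompact (L n)) (hK : IsCompact K) (hLne : ∀ n, (L n).Nonempty)
    (hKne : K.Nonempty) (hL01 : ∀ n, L n ⊆ Icc 0 1) (hK01 : K ⊆ Icc 0 1)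
    (hLL : ∀ n, L n ⊆ f '' L (n + 1)) (hLK : K ⊆ f '' L 0) (hL0 : ∀ n, L n ⊆ f '' L 0)
    (hKL : ∀ n, L n ⊆ f '' K) {d : ℝ} (hd : 0 < d) (hsep : ∀ x ∈ K, ∀ y ∈ L 0, d ≤ |x - y|)
    (w : ℕ → ℝ) (hw : Tendsto w atTop (nhds 0))
    (hdiam : ∀ n, ∀ x ∈ L n, ∀ y ∈ L n, |x - y| ≤ w n) : LiYorkeChaotic f := by
  have hc : ∀ ω s, IsCompact (excursionSet L K ω s) := by
    rintro ω ⟨n, _ | r⟩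
    · simp only [excursionSet]; split_ifs; exacts [hK, hL 0]
    · exact hL r
  have hne : ∀ ω s, (excursionSet L K ω s).Nonempty := by
    rintro ω ⟨n, _ | r⟩
    · simp only [excursionSet]; split_ifs; exacts [hKne, hLne 0]
    · exact hLne r
  have h01 : ∀ ω s, excursionSet L K ω s ⊆ Icc 0 1 := by
    rintro ω ⟨n, _ | r⟩
    · simp only [excursionSet]; split_ifs; exacts [hK01, hL01 0]
    · exact hL01 r
  have hcov : ∀ ω s, excursionSet L K ω (excursionStep s) ⊆ f '' excursionSet L K ω s := by
    rintro ω ⟨n, _ | _ | r⟩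
    · simp only [excursionSet, excursionStep]; split_ifs; exacts [hKL n, hL0 n]
    · simp only [excursionSet, excursionStep]; split_ifs; exacts [hLK, hL0 0]
    · exact hLL r
  have key : ∀ τ : ℕ → Bool, ∃ x, ∀ t, f^[t] x ∈
      excursionSet L K (fun n => τ n.unpair.1) (excursionStep^[t] (0, 0)) := fun τ =>
    exists_forall_iterate_mem hf _ (fun t => hc _ _) (fun t => hne _ _) fun t => by
      rw [Function.iterate_succ_apply']; exact hcov _ _
  choose X hX using key
  have hsepX : ∀ τ τ' : ℕ → Bool, τ ≠ τ' → ∃ᶠ t in atTop, d ≤ |f^[t] (X τ) - f^[t] (X τ')| := by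
    intro τ τ' hne
    obtain ⟨c, hc⟩ := Function.ne_iff.1 hne
    rw [frequently_atTop]
    intro N
    obtain ⟨t, ht, hst⟩ := exists_excursionStep_iterate_eq (Nat.pair c N)
    refine ⟨t, (Nat.right_le_pair c N).trans ht, ?_⟩
    have h1 := hX τ t
    have h2 := hX τ' t
    rw [hst] at h1 h2
    simp only [excursionSet, Nat.unpair_pair] at h1 h2
    cases hτ : τ c <;> cases hτ' : τ' c <;> simp [hτ, hτ'] at hc h1 h2
    · rw [abs_sub_comm]; exact hsep _ h2 _ h1
    · exact hsep _ h1 _ h2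
  have hinj : Function.Injective X := by
    intro τ τ' h
    by_contra hne
    obtain ⟨t, ht⟩ := (hsepX τ τ' hne).exists
    rw [h, sub_self, abs_zero] at ht
    linarith
  refine ⟨range X, ?_, ?_, ?_⟩
  · rintro _ ⟨τ, rfl⟩
    exact h01 _ _ (hX τ 0)
  · intro hcount
    have : Countable (ℕ → Bool) := by
      have := hcount.to_subtype
      exact (Set.rangeFactorization_injective.2 hinj).countable
    obtain ⟨e, he⟩ := exists_surjective_nat (ℕ → Bool)
    obtain ⟨n, hn⟩ := he fun n => !(e n n)
    simpa using congrFun hn n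
  · rintro _ ⟨τ, rfl⟩ _ ⟨τ', rfl⟩ hxy
    have hne : τ ≠ τ' := fun h => hxy (by rw [h])
    have hle1 : ∀ t, |f^[t] (X τ) - f^[t] (X τ')| ≤ 1 := by
      intro t
      have h1 := h01 _ _ (hX τ t)
      have h2 := h01 _ _ (hX τ' t)
      rw [abs_le]
      constructor <;> linarith [h1.1, h1.2, h2.1, h2.2]
    have hbdd : IsBoundedUnder (· ≤ ·) atTop fun t => |f^[t] (X τ) - f^[t] (X τ')| :=
      isBoundedUnder_of ⟨1, hle1⟩
    have hbdd' : IsBoundedUnder (· ≥ ·) atTop fun t => |f^[t] (X τ) - f^[t] (X τ')| :=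
      isBoundedUnder_of ⟨0, fun t => abs_nonneg _⟩
    constructor
    · refine le_antisymm (le_of_forall_pos_le_add fun ε hε => ?_)
        (le_liminf_of_le hbdd.isCoboundedUnder_ge (Eventually.of_forall fun t => abs_nonneg _))
      rw [zero_add]
      refine liminf_le_of_frequently_le (frequently_atTop.2 fun N => ?_) hbdd'
      obtain ⟨n, hn, hNn⟩ := ((hw.eventually (gt_mem_nhds hε)).and (eventually_ge_atTop N)).exists
      obtain ⟨t, ht, hst⟩ := exists_excursionStep_iterate_top n
      refine ⟨t, hNn.trans ht, ?_⟩
      have h1 := hX τ t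
      have h2 := hX τ' t
      rw [hst] at h1 h2
      exact (hdiam n _ h1 _ h2).trans hn.le
    · exact hd.trans_le (le_limsup_of_frequently_le (hsepX τ τ' hne) hbdd)

/-- A continuous map of the line going from `0` up to `1` and back to `0` inside `[0, 1)` is
Li-Yorke chaotic. -/
theorem liYorkeChaotic_of_up_down {f : ℝ → ℝ} (hf : Continuous f) {x₁ x₂ : ℝ} (h0 : 0 ≤ x₁)
    (h12 : x₁ < x₂) (h21 : x₂ < 1) (hf0 : f 0 = 0) (hf1 : f x₁ = 1) (hf2 : f x₂ = 0) :
    LiYorkeChaotic f := by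
  obtain ⟨c, hc, hfc⟩ : x₂ ∈ f '' Icc 0 x₁ :=
    intermediate_value_Icc h0 hf.continuousOn ⟨by rw [hf0]; linarith, by rw [hf1]; linarith⟩
  have hcx : c < x₁ := lt_of_le_of_ne hc.2 fun h => by rw [h, hf1] at hfc; linarith
  obtain ⟨z, ⟨hz, hfz⟩, hzmax⟩ : ∃ z, IsGreatest {x | x ∈ Icc 0 c ∧ f x = x} z := by
    refine IsCompact.exists_isGreatest ?_ ⟨0, ⟨le_rfl, hc.1⟩, hf0⟩
    exact isCompact_Icc.inter_right (isClosed_eq hf continuous_id)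
  have hzc : z < c := lt_of_le_of_ne hz.2 fun h => by rw [h, hfc] at hfz; linarith
  have habove : ∀ x, z < x → x ≤ c → x < f x := by
    intro x hzx hxc
    by_contra! hle
    obtain ⟨y, hy, hfy⟩ : (0 : ℝ) ∈ (fun x => f x - x) '' Icc x c :=
      intermediate_value_Icc hxc (by fun_prop) ⟨by linarith, by simp only [hfc]; linarith⟩
    have := hzmax ⟨⟨by linarith [hz.1, hy.1], hy.2⟩, by simpa [sub_eq_zero] using hfy⟩
    linarith [hy.1]
  have hstep : ∀ y : Ioc z c, ∃ y' : Ioc z c, y' ≤ y ∧ f y' = y := by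
    rintro ⟨y, hy⟩
    obtain ⟨y', hy', hfy⟩ : y ∈ f '' Ioc z y :=
      intermediate_value_Ioc hy.1.le hf.continuousOn ⟨by rw [hfz]; exact hy.1, (habove y hy.1 hy.2).le⟩
    exact ⟨⟨y', hy'.1, hy'.2.trans hy.2⟩, hy'.2, hfy⟩
  choose g hg hfg using hstep
  let w : ℕ → ℝ := fun n => (g^[n] ⟨c, hzc, le_rfl⟩ : Ioc z c)
  have hwmem : ∀ n, w n ∈ Ioc z c := fun n => Subtype.property _
  have hfw : ∀ n, f (w (n + 1)) = w n := fun n => by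
    simp only [w, Function.iterate_succ_apply', hfg]
  have hanti : Antitone w := antitone_nat_of_succ_le fun n => by
    simp only [w, Function.iterate_succ_apply']
    exact hg _
  have hbdd : BddBelow (range w) := ⟨z, by rintro _ ⟨n, rfl⟩; exact (hwmem n).1.le⟩
  have hlim := tendsto_atTop_ciInf hanti hbdd
  have hwz : Tendsto w atTop (nhds z) := by
    have hfix : f (⨅ n, w n) = ⨅ n, w n := by
      refine tendsto_nhds_unique (((hf.tendsto _).comp (hlim.comp (tendsto_add_atTop_nat 1)))) ?_
      simpa [Function.comp_def, hfw] using hlim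
    have hge : z ≤ ⨅ n, w n := le_ciInf fun n => (hwmem n).1.le
    have hle : ⨅ n, w n ≤ z := hzmax ⟨⟨hz.1.trans hge, (ciInf_le hbdd 0).trans (hwmem 0).2⟩, hfix⟩
    rwa [le_antisymm hle hge] at hlim
  have hw0 : w 0 = c := rfl
  have hcover0 : Icc z x₂ ⊆ f '' Icc z (w 0) := by
    have := intermediate_value_Icc (hwmem 0).1.le (hf.continuousOn (s := Icc z (w 0)))
    rwa [hfz, hw0, hfc] at this
  have hcoverK : Icc 0 1 ⊆ f '' Icc x₁ x₂ := by
    have := intermediate_value_Icc' h12.le (hf.continuousOn (s := Icc x₁ x₂))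
    rwa [hf1, hf2] at this
  refine liYorkeChaotic_of_covering hf (fun n => Icc z (w n)) (Icc x₁ x₂)
    (fun n => isCompact_Icc) isCompact_Icc (fun n => nonempty_Icc.2 (hwmem n).1.le)
    (nonempty_Icc.2 h12.le) (fun n => Icc_subset_Icc hz.1 (by linarith [(hwmem n).2]))
    (Icc_subset_Icc h0 h21.le) (fun n => ?_) ((Icc_subset_Icc (by linarith) le_rfl).trans hcover0)
    (fun n => (Icc_subset_Icc le_rfl (by linarith [(hwmem n).2])).trans hcover0)
    (fun n => (Icc_subset_Icc hz.1 (by linarith [(hwmem n).2])).trans hcoverK)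
    (sub_pos.2 hcx) ?_ (fun n => w n - z) (by simpa using hwz.sub_const z) ?_
  · have := intermediate_value_Icc (hwmem (n + 1)).1.le (hf.continuousOn (s := Icc z (w (n + 1))))
    rwa [hfz, hfw] at this
  · intro x hx y hy
    exact le_trans (by linarith [hx.1, hy.2]) (le_abs_self _)
  · intro n x hx y hy
    rw [abs_le]
    constructor <;> linarith [hx.1, hx.2, hy.1, hy.2]

theorem map_sum_mul_pi_gaussianReal {ι : Type*} [Fintype ι] (v : ℝ≥0) (c : ι → ℝ) {V : ℝ≥0}
    (hV : (V : ℝ) = v * ∑ i, c i ^ 2) :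
    (Measure.pi fun _ : ι => gaussianReal 0 v).map (fun a => ∑ i, c i * a i)
      = gaussianReal 0 V := by
  have hmeas : ∀ i, Measurable fun a : ι → ℝ => c i * a i := fun i => by fun_prop
  refine Measure.ext_of_charFun ?_
  rw [iIndepFun.charFun_map_fun_sum_eq_prod (X := fun i (a : ι → ℝ) => c i * a i)
    (fun i => (hmeas i).aemeasurable)
    (iIndepFun_pi (X := fun i (x : ℝ) => c i * x) fun i => by fun_prop)]
  ext t
  have hmap : ∀ i, (Measure.pi fun _ : ι => gaussianReal 0 v).map (fun a => c i * a i)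
      = gaussianReal 0 (‖c i‖₊ ^ 2 * v) := by
    intro i
    have h := gaussianReal_map_const_mul (μ := 0) (v := v) (c i)
    rw [mul_zero, ← (measurePreserving_eval (fun _ : ι => gaussianReal 0 v) i).map_eq,
      Measure.map_map (by fun_prop) (by fun_prop)] at h
    refine h.trans ?_
    congr 2
    ext
    simp
  simp only [Finset.prod_apply, hmap, charFun_gaussianReal, ← Complex.exp_sum]
  congr 1
  have : (V : ℂ) = v * ∑ i, (c i : ℂ) ^ 2 := by exact_mod_cast congrArg ((↑) : ℝ → ℂ) hV
  simp [this, Finset.mul_sum, Finset.sum_div, mul_comm]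

theorem gaussianReal_Ioi_zero {V : ℝ≥0} (hV : V ≠ 0) : gaussianReal 0 V (Ioi 0) = 1 / 2 := by
  have hneg : gaussianReal 0 V (Iio 0) = gaussianReal 0 V (Ioi 0) := by
    conv_rhs => rw [← neg_zero, ← gaussianReal_map_neg, Measure.map_apply (by fun_prop)
      measurableSet_Ioi]
    congr 1
    ext x
    simp
  have := nullSingletonClass_gaussianReal (μ := 0) hV
  have htot : gaussianReal 0 V (Iio 0) + gaussianReal 0 V (Ioi 0) = 1 := by
    rw [← measure_union (by
      rw [Set.disjoint_left]; intro x hx hx'; exact lt_asymm (mem_Iio.1 hx) (mem_Ioi.1 hx'))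
      measurableSet_Ioi, Iio_union_Ioi, ← prob_add_prob_compl (MeasurableSet.singleton (0 : ℝ))
      (μ := gaussianReal 0 V), measure_singleton, zero_add]
  rw [hneg, ← two_mul] at htot
  rw [ENNReal.eq_div_iff (by norm_num) (by norm_num), htot]

theorem gaussianReal_Iio_zero {V : ℝ≥0} (hV : V ≠ 0) : gaussianReal 0 V (Iio 0) = 1 / 2 := by
  have h := gaussianReal_map_neg (μ := 0) (v := V)
  rw [neg_zero] at h
  rw [← gaussianReal_Ioi_zero hV]
  conv_lhs => rw [← h, Measure.map_apply (by fun_prop) measurableSet_Iio]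
  congr 1
  ext x
  simp

theorem gaussianReal_Icc_le {V : ℝ≥0} (hV : V ≠ 0) (r : ℝ) :
    gaussianReal 0 V (Icc (-r) r) ≤ ENNReal.ofReal (r / √V) := by
  have hVpos : (0 : ℝ) < V := by positivity
  have hpdf : ∀ x, gaussianPDF 0 V x ≤ ENNReal.ofReal (1 / (2 * √V)) := by
    intro x
    refine ENNReal.ofReal_le_ofReal ?_
    rw [gaussianPDFReal_def]
    have h1 : Real.exp (-(x - 0) ^ 2 / (2 * V)) ≤ 1 := by
      rw [Real.exp_le_one_iff]
      exact div_nonpos_of_nonpos_of_nonneg (by nlinarith [sq_nonneg (x - 0)]) (by positivity)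
    have h2 : 2 * √V ≤ √(2 * Real.pi * V) := by
      rw [Real.sqrt_mul (by positivity)]
      refine mul_le_mul_of_nonneg_right ?_ (Real.sqrt_nonneg _)
      exact Real.le_sqrt_of_sq_le (by nlinarith [Real.pi_gt_three])
    have hsV : 0 < √(V : ℝ) := Real.sqrt_pos.2 hVpos
    calc (√(2 * Real.pi * V))⁻¹ * Real.exp (-(x - 0) ^ 2 / (2 * V))
        ≤ (√(2 * Real.pi * V))⁻¹ * 1 := by gcongr
      _ ≤ 1 / (2 * √V) := by
        rw [mul_one, ← one_div]
        gcongr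
  rw [gaussianReal_apply 0 hV]
  calc ∫⁻ x in Icc (-r) r, gaussianPDF 0 V x
      ≤ ∫⁻ _ in Icc (-r) r, ENNReal.ofReal (1 / (2 * √V)) := lintegral_mono fun x => hpdf x
    _ = ENNReal.ofReal (r / √V) := by
      rw [setLIntegral_const, Real.volume_Icc, ← ENNReal.ofReal_mul (by positivity)]
      congr 1
      field_simp
      ring

theorem gaussianReal_le_abs_le (W : ℝ≥0) {s : ℝ} (hs : 0 < s) :
    gaussianReal 0 W {x | s ≤ |x|} ≤ ENNReal.ofReal (W / s ^ 2) := by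
  have := meas_ge_le_variance_div_sq (memLp_id_gaussianReal (μ := 0) (v := W) 2) hs
  simpa using this

/-- Under a product measure, events that depend on disjoint sets of coordinates are
independent. -/
theorem measure_pi_inter_of_disjoint {ι : Type*} [Fintype ι] (μ : Measure ℝ)
    [IsProbabilityMeasure μ] {S T : Finset ι} (hST : Disjoint S T) {A B : Set (ι → ℝ)}
    (hA : MeasurableSet A) (hB : MeasurableSet B)
    (hAS : ∀ a a' : ι → ℝ, (∀ i ∈ S, a i = a' i) → a ∈ A → a' ∈ A)
    (hBT : ∀ a a' : ι → ℝ, (∀ i ∈ T, a i = a' i) → a ∈ B → a' ∈ B) :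
    (Measure.pi fun _ => μ) (A ∩ B)
      = (Measure.pi fun _ => μ) A * (Measure.pi fun _ => μ) B := by
  classical
  let ext (S : Finset ι) (y : S → ℝ) (i : ι) : ℝ := if h : i ∈ S then y ⟨i, h⟩ else 0
  have hext : ∀ S, Measurable (ext S) := by
    intro S
    refine measurable_pi_iff.2 fun i => ?_
    by_cases h : i ∈ S
    · simp only [ext, h, dite_true]; fun_prop
    · simp only [ext, h, dite_false]; fun_prop
  have hpre : ∀ (S : Finset ι) (A : Set (ι → ℝ)),
      (∀ a a' : ι → ℝ, (∀ i ∈ S, a i = a' i) → a ∈ A → a' ∈ A) →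
      A = (fun (a : ι → ℝ) (i : S) => a i) ⁻¹' (ext S ⁻¹' A) := by
    intro S A h
    ext a
    constructor
    · exact h _ _ fun i hi => by simp [ext, hi]
    · exact h _ _ fun i hi => by simp [ext, hi]
  have hind := (iIndepFun_pi (μ := fun _ : ι => μ) (X := fun _ x => x)
    (fun _ => aemeasurable_id)).indepFun_finset S T hST (fun i => by fun_prop)
  have := hind.measure_inter_preimage_eq_mul _ _ (hext S hA) (hext T hB)
  rwa [← hpre S A hAS, ← hpre T B hBT] at this

theorem measure_pi_gaussianReal_linear {ι : Type*} [Fintype ι] {v : ℝ≥0} {c : ι → ℝ} {V : ℝ≥0}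
    (hV : (V : ℝ) = v * ∑ i, c i ^ 2) {B : Set ℝ} (hB : MeasurableSet B) :
    (Measure.pi fun _ : ι => gaussianReal 0 v) {a | ∑ i, c i * a i ∈ B} = gaussianReal 0 V B := by
  rw [← map_sum_mul_pi_gaussianReal v c hV, Measure.map_apply (by fun_prop) hB]
  rfl

theorem measurableSet_linear {ι : Type*} [Fintype ι] (c : ι → ℝ) {B : Set ℝ}
    (hB : MeasurableSet B) : MeasurableSet {a : ι → ℝ | ∑ i, c i * a i ∈ B} := by
  have : Measurable fun a : ι → ℝ => ∑ i, c i * a i := by fun_prop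
  exact this hB

theorem linear_eq_of_eqOn {ι : Type*} [Fintype ι] {c a a' : ι → ℝ} {S : Finset ι}
    (hS : ∀ i, c i ≠ 0 → i ∈ S) (h : ∀ i ∈ S, a i = a' i) :
    ∑ i, c i * a i = ∑ i, c i * a' i := by
  refine Finset.sum_congr rfl fun i _ => ?_
  by_cases hc : c i = 0
  · simp [hc]
  · rw [h i (hS i hc)]

theorem measure_forall_not_pos_neg {ι : Type*} [Fintype ι] (v : ℝ≥0) (u : ℕ → ι → ℝ)
    (hdisj : ∀ i j j', u j i ≠ 0 → u j' i ≠ 0 → j = j') (V : ℕ → ℝ≥0)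
    (hV : ∀ j, (V j : ℝ) = v * ∑ i, u j i ^ 2) (m : ℕ) (hV0 : ∀ j < 2 * m, V j ≠ 0) :
    (Measure.pi fun _ : ι => gaussianReal 0 v)
      {a | ∀ p < m, ¬(0 < ∑ i, u (2 * p + 1) i * a i ∧ ∑ i, u (2 * p) i * a i < 0)}
      = (3 / 4) ^ m := by
  classical
  set P := Measure.pi fun _ : ι => gaussianReal 0 v
  induction m with
  | zero => simp
  | succ m ih =>
    have hpos := measurableSet_linear (u (2 * m + 1)) (measurableSet_Ioi (a := 0))
    have hneg := measurableSet_linear (u (2 * m)) (measurableSet_Iio (a := 0))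
    have hquarter : P ({a | ∑ i, u (2 * m + 1) i * a i ∈ Ioi 0} ∩
        {a | ∑ i, u (2 * m) i * a i ∈ Iio 0}) = 1 / 4 := by
      rw [measure_pi_inter_of_disjoint (gaussianReal 0 v)
        (S := Finset.univ.filter fun i => u (2 * m + 1) i ≠ 0)
        (T := Finset.univ.filter fun i => u (2 * m) i ≠ 0) ?_ hpos hneg,
        measure_pi_gaussianReal_linear (hV _) measurableSet_Ioi,
        measure_pi_gaussianReal_linear (hV _) measurableSet_Iio,
        gaussianReal_Ioi_zero (hV0 _ (by omega)), gaussianReal_Iio_zero (hV0 _ (by omega))]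
      · rw [one_div, one_div, ← ENNReal.mul_inv (by norm_num) (by norm_num)]
        norm_num
      · intro a a' h ha
        rwa [mem_ofPred_eq, ← linear_eq_of_eqOn (by simp) h]
      · intro a a' h ha
        rwa [mem_ofPred_eq, ← linear_eq_of_eqOn (by simp) h]
      · rw [Finset.disjoint_left]
        intro i hi hi'
        have := hdisj i _ _ (Finset.mem_filter.1 hi).2 (Finset.mem_filter.1 hi').2
        omega
    have hmeas : ∀ p, MeasurableSet
        {a : ι → ℝ | ¬(0 < ∑ i, u (2 * p + 1) i * a i ∧ ∑ i, u (2 * p) i * a i < 0)} := fun p =>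
      ((measurableSet_linear (u (2 * p + 1)) (measurableSet_Ioi (a := 0))).inter
        (measurableSet_linear (u (2 * p)) (measurableSet_Iio (a := 0)))).compl
    have hthree : P {a | ¬(0 < ∑ i, u (2 * m + 1) i * a i ∧ ∑ i, u (2 * m) i * a i < 0)}
        = 3 / 4 := by
      have h := prob_compl_eq_one_sub (μ := P) (hpos.inter hneg)
      rw [hquarter] at h
      refine Eq.trans (congrArg P rfl) (h.trans ?_)
      rw [← ENNReal.toReal_eq_toReal_iff' (by simp) (by finiteness),
        ENNReal.toReal_sub_of_le (by norm_num) (by simp)]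
      norm_num
    have hsplit : {a : ι → ℝ | ∀ p < m + 1,
          ¬(0 < ∑ i, u (2 * p + 1) i * a i ∧ ∑ i, u (2 * p) i * a i < 0)}
        = {a | ∀ p < m, ¬(0 < ∑ i, u (2 * p + 1) i * a i ∧ ∑ i, u (2 * p) i * a i < 0)} ∩
          {a | ¬(0 < ∑ i, u (2 * m + 1) i * a i ∧ ∑ i, u (2 * m) i * a i < 0)} := by
      ext a
      simp only [mem_ofPred_eq, mem_inter_iff, Nat.lt_succ_iff_lt_or_eq, or_imp, forall_and,
        forall_eq]
    rw [hsplit, measure_pi_inter_of_disjoint (gaussianReal 0 v)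
      (S := Finset.univ.filter fun i => ∃ j < 2 * m, u j i ≠ 0)
      (T := Finset.univ.filter fun i => u (2 * m) i ≠ 0 ∨ u (2 * m + 1) i ≠ 0) ?_ ?_ (hmeas m),
      ih fun j hj => hV0 j (by omega), hthree, pow_succ]
    · intro a a' h ha p hp
      rw [← linear_eq_of_eqOn (a := a) (c := u (2 * p)) (fun i hi => ?_) h,
        ← linear_eq_of_eqOn (a := a) (c := u (2 * p + 1)) (fun i hi => ?_) h]
      · exact ha p hp
      · simpa using ⟨_, by omega, hi⟩
      · simpa using ⟨_, by omega, hi⟩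
    · intro a a' h ha
      rw [mem_ofPred_eq, ← linear_eq_of_eqOn (a := a) (c := u (2 * m)) (fun i hi => ?_) h,
        ← linear_eq_of_eqOn (a := a) (c := u (2 * m + 1)) (fun i hi => ?_) h]
      · exact ha
      · simp [hi]
      · simp [hi]
    · rw [Finset.disjoint_left]
      intro i hi hi'
      obtain ⟨j, hj, hji⟩ := (Finset.mem_filter.1 hi).2
      rcases (Finset.mem_filter.1 hi').2 with h | h <;>
        · have := hdisj i _ _ hji h
          omega
    · simp only [ofPred_forall]
      exact MeasurableSet.iInter fun p => MeasurableSet.iInter fun _ => hmeas p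

/-- If the independent Gaussian parts `∑ i, u j i * a i` dominate the remainders
`∑ i, r j i * a i`, then some consecutive pair of sums has prescribed signs with high
probability. -/
theorem measure_forall_not_one_le_and_nonpos_le {ι : Type*} [Fintype ι] (v : ℝ≥0)
    (u r : ℕ → ι → ℝ) (hdisj : ∀ i j j', u j i ≠ 0 → u j' i ≠ 0 → j = j') (m : ℕ) {η : ℝ}
    (hη : 0 ≤ η) (s : ℕ → ℝ) (hs : ∀ j < 2 * m, 1 ≤ s j)
    (hsu : ∀ j < 2 * m, s j ≤ η * √(v * ∑ i, u j i ^ 2))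
    (hsr : ∀ j < 2 * m, v * ∑ i, r j i ^ 2 ≤ η * s j ^ 2) :
    (Measure.pi fun _ : ι => gaussianReal 0 v)
      {a | ∀ p < m, ¬(1 ≤ ∑ i, (u (2 * p + 1) i + r (2 * p + 1) i) * a i ∧
        ∑ i, (u (2 * p) i + r (2 * p) i) * a i ≤ 0)}
      ≤ (3 / 4) ^ m + ENNReal.ofReal (6 * m * η) := by
  set P := Measure.pi fun _ : ι => gaussianReal 0 v
  have hnonneg : ∀ c : ι → ℝ, 0 ≤ v * ∑ i, c i ^ 2 := fun c =>
    mul_nonneg v.2 (Finset.sum_nonneg fun i _ => sq_nonneg _)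
  let V : ℕ → ℝ≥0 := fun j => ⟨v * ∑ i, u j i ^ 2, hnonneg _⟩
  let W : ℕ → ℝ≥0 := fun j => ⟨v * ∑ i, r j i ^ 2, hnonneg _⟩
  have hV : ∀ j, (V j : ℝ) = v * ∑ i, u j i ^ 2 := fun _ => rfl
  have hW : ∀ j, (W j : ℝ) = v * ∑ i, r j i ^ 2 := fun _ => rfl
  have hVpos : ∀ j < 2 * m, 0 < √(V j : ℝ) := fun j hj => by
    by_contra! h
    have h1 := hsu j hj
    rw [← hV] at h1
    linarith [hs j hj, mul_nonpos_of_nonneg_of_nonpos hη h]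
  have hV0 : ∀ j < 2 * m, V j ≠ 0 := fun j hj h => by
    simpa [h] using hVpos j hj
  have hsmall : ∀ j < 2 * m, P {a | ∑ i, u j i * a i ∈ Icc (-(2 * s j)) (2 * s j)}
      ≤ ENNReal.ofReal (2 * η) := fun j hj => by
    rw [measure_pi_gaussianReal_linear (hV j) measurableSet_Icc]
    refine (gaussianReal_Icc_le (hV0 j hj) _).trans (ENNReal.ofReal_le_ofReal ?_)
    rw [div_le_iff₀ (hVpos j hj), hV]
    linarith [hsu j hj]
  have hlarge : ∀ j < 2 * m, P {a | ∑ i, r j i * a i ∈ {x | s j ≤ |x|}}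
      ≤ ENNReal.ofReal η := fun j hj => by
    have hsj : 0 < s j := by linarith [hs j hj]
    rw [measure_pi_gaussianReal_linear (hW j) (measurableSet_le measurable_const
      measurable_abs)]
    refine (gaussianReal_le_abs_le _ hsj).trans (ENNReal.ofReal_le_ofReal ?_)
    rw [div_le_iff₀ (by positivity), hW]
    exact hsr j hj
  calc P _ ≤ P ({a | ∀ p < m, ¬(0 < ∑ i, u (2 * p + 1) i * a i ∧ ∑ i, u (2 * p) i * a i < 0)} ∪
        ⋃ j ∈ Finset.range (2 * m), ({a | ∑ i, u j i * a i ∈ Icc (-(2 * s j)) (2 * s j)} ∪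
          {a | ∑ i, r j i * a i ∈ {x | s j ≤ |x|}})) := by
        refine measure_mono fun a ha => ?_
        by_contra hcon
        simp only [mem_union, mem_iUnion, mem_ofPred_eq, not_or, not_exists, not_forall, not_not,
          mem_Icc, not_and, not_le, Finset.mem_range] at hcon ha
        obtain ⟨⟨p, hp, hpos, hneg⟩, hbig⟩ := hcon
        obtain ⟨hu1, hr1⟩ := hbig (2 * p + 1) (by omega)
        obtain ⟨hu0, hr0⟩ := hbig (2 * p) (by omega)
        have hs1 := hs (2 * p + 1) (by omega)
        have hs0 := hs (2 * p) (by omega)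
        rw [abs_lt] at hr1 hr0
        have h1 := hu1 (by linarith)
        have h0 : ∑ i, u (2 * p) i * a i < -(2 * s (2 * p)) := by
          by_contra! h
          linarith [hu0 h]
        have := ha p hp
        simp only [add_mul, Finset.sum_add_distrib] at this
        linarith [this (by linarith)]
    _ ≤ (3 / 4) ^ m + ∑ j ∈ Finset.range (2 * m),
          (ENNReal.ofReal (2 * η) + ENNReal.ofReal η) := by
        refine (measure_union_le _ _).trans (add_le_add
          (measure_forall_not_pos_neg v u hdisj V hV m hV0).le ?_)
        refine (measure_biUnion_finset_le _ _).trans (Finset.sum_le_sum fun j hj => ?_)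
        rw [Finset.mem_range] at hj
        exact (measure_union_le _ _).trans (add_le_add (hsmall j hj) (hlarge j hj))
    _ = (3 / 4) ^ m + ENNReal.ofReal (6 * m * η) := by
        rw [← ENNReal.ofReal_add (by positivity) hη, Finset.sum_const, Finset.card_range,
          nsmul_eq_mul, ← ENNReal.ofReal_natCast, ← ENNReal.ofReal_mul (by positivity)]
        push_cast
        ring_nf

/-- Quantitative law of large numbers for the number of samples falling in a set. -/
theorem measure_count_deviation_le (μ : Measure ℝ) [IsProbabilityMeasure μ] {I : Set ℝ}
    (hI : MeasurableSet I) (hp : 0 < μ.real I) {k : ℕ} (hk : 0 < k) :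
    (Measure.pi fun _ : Fin k => μ)
      {b | k * μ.real I / 2 ≤ |∑ i, I.indicator (fun _ => (1 : ℝ)) (b i) - k * μ.real I|}
      ≤ ENNReal.ofReal ((μ.real I ^ 2)⁻¹ * (k : ℝ)⁻¹) := by
  have hk' : (0 : ℝ) < k := by exact_mod_cast hk
  have hmeas : Measurable (I.indicator fun _ => (1 : ℝ)) := measurable_const.indicator hI
  have h01 : ∀ x, I.indicator (fun _ => (1 : ℝ)) x ∈ Icc (0 : ℝ) 1 := fun x => by
    by_cases h : x ∈ I <;> simp [h]
  have hLp : MemLp (I.indicator fun _ => (1 : ℝ)) 2 μ :=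
    memLp_indicator_const 2 hI 1 (Or.inr (measure_ne_top _ _))
  set X : (Fin k → ℝ) → ℝ := ∑ i, fun b => I.indicator (fun _ => (1 : ℝ)) (b i)
  have hX : ∀ b, X b = ∑ i, I.indicator (fun _ => (1 : ℝ)) (b i) := fun b => by
    simp [X, Finset.sum_apply]
  have hXi : ∀ i : Fin k, MemLp (fun b : Fin k → ℝ => I.indicator (fun _ => (1 : ℝ)) (b i)) 2
      (Measure.pi fun _ : Fin k => μ) := fun i =>
    hLp.comp_measurePreserving (measurePreserving_eval _ i)
  have hXLp : MemLp X 2 (Measure.pi fun _ : Fin k => μ) :=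
    memLp_finsetSum' _ fun i _ => hXi i
  have hmean : (Measure.pi fun _ : Fin k => μ)[X] = k * μ.real I := by
    simp only [hX]
    rw [integral_finsetSum _ fun i _ => (hXi i).integrable (by norm_num)]
    simp only [integral_comp_eval (μ := fun _ : Fin k => μ) hmeas.aestronglyMeasurable]
    simp [integral_indicator_const, hI]
  have hvar : Var[X; Measure.pi fun _ : Fin k => μ] ≤ k * (1 / 4) := by
    rw [variance_sum_pi (μ := fun _ : Fin k => μ) (X := fun _ => I.indicator fun _ => (1 : ℝ))
      fun _ => hLp]
    have := variance_le_sq_of_bounded (μ := μ) (a := 0) (b := 1) (Eventually.of_forall h01)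
      hmeas.aemeasurable
    rw [Finset.sum_const, Finset.card_univ, Fintype.card_fin, nsmul_eq_mul]
    gcongr
    exact this.trans (by norm_num)
  have h := meas_ge_le_variance_div_sq hXLp (c := k * μ.real I / 2) (by positivity)
  rw [hmean] at h
  simp only [hX] at h
  refine h.trans (ENNReal.ofReal_le_ofReal ?_)
  calc _ ≤ k * (1 / 4) / (k * μ.real I / 2) ^ 2 := by gcongr
    _ = _ := by field_simp; ring

theorem tendsto_measure_count_deviation (μ : Measure ℝ) [IsProbabilityMeasure μ] {I : Set ℝ}
    (hI : MeasurableSet I) (hp : 0 < μ.real I) :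
    Tendsto (fun k : ℕ => (Measure.pi fun _ : Fin k => μ)
      {b | k * μ.real I / 2 ≤ |∑ i, I.indicator (fun _ => (1 : ℝ)) (b i) - k * μ.real I|})
      atTop (nhds 0) := by
  refine tendsto_of_tendsto_of_tendsto_of_le_of_le' tendsto_const_nhds ?_
    (Eventually.of_forall fun _ => zero_le)
    ((eventually_gt_atTop 0).mono fun k hk => measure_count_deviation_le μ hI hp hk)
  rw [← ENNReal.ofReal_zero]
  refine ENNReal.tendsto_ofReal ?_
  simpa using (tendsto_inv_atTop_nhds_zero_nat (𝕜 := ℝ)).const_mul ((μ.real I ^ 2)⁻¹)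

/-- For biases that are well spread at the scales `q ^ (j + 1)`, the preactivation changes sign
between two consecutive scales with high probability. -/
theorem measure_no_sign_change_le {k : ℕ} (hk : 0 < k) {b : Fin k → ℝ} (hb : ∀ i, 0 ≤ b i)
    {σ η q : ℝ} (hη : 0 < η) (hη1 : η ≤ 1) (hq : 0 < q) (hqη : 64 * q ≤ η ^ 3) (m : ℕ)
    (hσ : ∀ j < 2 * m, 32 ≤ η ^ 2 * (σ ^ 2 * (q ^ (j + 1)) ^ 3))
    (hupper : ∀ j < 2 * m,
      ∑ i, (Iic (q ^ (j + 2))).indicator (fun _ => (1 : ℝ)) (b i) ≤ 2 * (k * q ^ (j + 2)))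
    (hlower : ∀ j < 2 * m, k * q ^ (j + 1) / 8
      ≤ ∑ i, (Ioc (q ^ (j + 2)) (q ^ (j + 1) / 2)).indicator (fun _ => (1 : ℝ)) (b i)) :
    (Measure.pi fun _ : Fin k => gaussianReal 0 (σ ^ 2 / k).toNNReal)
      {a | ∀ p < m, ¬(1 ≤ ∑ i, a i * max (q ^ (2 * p + 2) - b i) 0 ∧
        ∑ i, a i * max (q ^ (2 * p + 1) - b i) 0 ≤ 0)}
      ≤ (3 / 4) ^ m + ENNReal.ofReal (6 * m * η) := by
  have hk' : (0 : ℝ) < k := by exact_mod_cast hk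
  have hq1 : q ≤ 1 := by nlinarith [pow_le_one₀ hη.le hη1 (n := 3)]
  let t : ℕ → ℝ := fun j => q ^ (j + 1)
  have htpos : ∀ j, 0 < t j := fun j => by positivity
  have hstep : ∀ j, t (j + 1) ≤ t j := fun j => pow_le_pow_of_le_one hq.le hq1 (by omega)
  have hanti : Antitone t := fun i j h => pow_le_pow_of_le_one hq.le hq1 (by omega)
  let u : ℕ → Fin k → ℝ := fun j i => if t (j + 1) < b i ∧ b i ≤ t j then t j - b i else 0
  let r : ℕ → Fin k → ℝ := fun j i => if b i ≤ t (j + 1) then t j - b i else 0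
  have hur : ∀ j i, u j i + r j i = max (t j - b i) 0 := by
    intro j i
    have := hstep j
    simp only [u, r]
    split_ifs with h1 h2 h2
    · linarith [h1.1]
    · rw [max_eq_left (by linarith [h1.2]), add_zero]
    · rw [max_eq_left (by linarith), zero_add]
    · rw [max_eq_right, add_zero]
      by_contra! h
      exact h1 ⟨by linarith, by linarith⟩
  have hdisj : ∀ i j j', u j i ≠ 0 → u j' i ≠ 0 → j = j' := by
    have : ∀ i j j', u j i ≠ 0 → u j' i ≠ 0 → j' ≤ j := by
      intro i j j' h h'
      by_contra! hlt
      simp only [u, ne_eq, ite_eq_right_iff, not_forall] at h h'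
      obtain ⟨⟨h1, -⟩, -⟩ := h
      obtain ⟨⟨-, h2⟩, -⟩ := h'
      have := hanti (show j + 1 ≤ j' from hlt)
      linarith
    exact fun i j j' h h' => le_antisymm (this i j' j h' h) (this i j j' h h')
  have hv : ((σ ^ 2 / k).toNNReal : ℝ) = σ ^ 2 / k := Real.coe_toNNReal _ (by positivity)
  have hV : ∀ j < 2 * m, σ ^ 2 * t j ^ 3 / 32 ≤ σ ^ 2 / k * ∑ i, u j i ^ 2 := by
    intro j hj
    have h : t j ^ 2 / 4 * ∑ i, (Ioc (t (j + 1)) (t j / 2)).indicator (fun _ => (1 : ℝ)) (b i)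
        ≤ ∑ i, u j i ^ 2 := by
      rw [Finset.mul_sum]
      refine Finset.sum_le_sum fun i _ => ?_
      by_cases hi : b i ∈ Ioc (t (j + 1)) (t j / 2)
      · have h1 : u j i = t j - b i := if_pos ⟨hi.1, by linarith [hi.2, htpos j]⟩
        rw [indicator_of_mem hi, h1]
        nlinarith [hi.2, htpos j]
      · rw [indicator_of_notMem hi, mul_zero]
        positivity
    calc σ ^ 2 * t j ^ 3 / 32 = σ ^ 2 / k * (t j ^ 2 / 4 * (k * t j / 8)) := by
          field_simp; ring
      _ ≤ σ ^ 2 / k * (t j ^ 2 / 4 *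
          ∑ i, (Ioc (t (j + 1)) (t j / 2)).indicator (fun _ => (1 : ℝ)) (b i)) := by
          gcongr; exact hlower j hj
      _ ≤ _ := by gcongr
  have hW : ∀ j < 2 * m, σ ^ 2 / k * ∑ i, r j i ^ 2 ≤ 2 * σ ^ 2 * (q * t j ^ 3) := by
    intro j hj
    have h : ∑ i, r j i ^ 2
        ≤ t j ^ 2 * ∑ i, (Iic (t (j + 1))).indicator (fun _ => (1 : ℝ)) (b i) := by
      rw [Finset.mul_sum]
      refine Finset.sum_le_sum fun i _ => ?_
      by_cases hi : b i ≤ t (j + 1)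
      · have h1 : r j i = t j - b i := if_pos hi
        rw [indicator_of_mem (mem_Iic.2 hi), h1]
        nlinarith [hb i, htpos j, hstep j]
      · have h1 : r j i = 0 := if_neg hi
        rw [indicator_of_notMem (by simpa using hi), h1]
        simp
    calc _ ≤ σ ^ 2 / k * (t j ^ 2 *
          ∑ i, (Iic (t (j + 1))).indicator (fun _ => (1 : ℝ)) (b i)) := by gcongr
      _ ≤ σ ^ 2 / k * (t j ^ 2 * (2 * (k * t (j + 1)))) := by
          gcongr; exact hupper j hj
      _ = _ := by
          simp only [t]
          field_simp
          ring
  have hmain := measure_forall_not_one_le_and_nonpos_le (σ ^ 2 / k).toNNReal u r hdisj m hη.le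
    (fun j => η * √((σ ^ 2 / k).toNNReal * ∑ i, u j i ^ 2)) ?_ (fun j _ => le_rfl) ?_
  · simpa only [hur, mul_comm (max _ _), t] using hmain
  · intro j hj
    have h32 : 1 ≤ η ^ 2 * (σ ^ 2 / k * ∑ i, u j i ^ 2) := by
      have := mul_le_mul_of_nonneg_left (hV j hj) (sq_nonneg η)
      have := hσ j hj
      simp only [t] at *
      linarith
    rw [hv, ← Real.sqrt_sq hη.le, ← Real.sqrt_mul (sq_nonneg η)]
    exact Real.one_le_sqrt.2 h32
  · intro j hj
    have h0 : 0 ≤ σ ^ 2 / k * ∑ i, u j i ^ 2 :=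
      mul_nonneg (by positivity) (Finset.sum_nonneg fun i _ => sq_nonneg _)
    rw [hv, mul_pow, Real.sq_sqrt h0]
    calc _ ≤ 2 * σ ^ 2 * (q * t j ^ 3) := hW j hj
      _ = 64 * q * (σ ^ 2 * t j ^ 3 / 32) := by ring
      _ ≤ η ^ 3 * (σ ^ 2 / k * ∑ i, u j i ^ 2) := by
        have := htpos j
        exact mul_le_mul hqη (hV j hj) (by positivity) (by positivity)
      _ = _ := by ring

theorem continuous_rnnStep {k : ℕ} (a b : Fin k → ℝ) : Continuous (rnnStep a b) := by
  unfold rnnStep clip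
  fun_prop

theorem liYorkeChaotic_rnnStep {k : ℕ} {a b : Fin k → ℝ} (hb : ∀ i, 0 ≤ b i) {x₁ x₂ : ℝ}
    (h0 : 0 ≤ x₁) (h12 : x₁ < x₂) (h21 : x₂ < 1) (h1 : 1 ≤ ∑ i, a i * max (x₁ - b i) 0)
    (h2 : ∑ i, a i * max (x₂ - b i) 0 ≤ 0) : LiYorkeChaotic (rnnStep a b) := by
  refine liYorkeChaotic_of_up_down (continuous_rnnStep a b) h0 h12 h21 ?_ ?_ ?_
  · have : ∀ i, max (-b i) 0 = 0 := fun i => max_eq_right (by linarith [hb i])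
    simp [rnnStep, clip, this]
  · rw [rnnStep, clip, max_eq_left (by linarith), min_eq_right h1]
  · rw [rnnStep, clip, max_eq_right h2, min_eq_left zero_le_one]

instance isProbabilityMeasure_restrict_Icc_zero_one :
    IsProbabilityMeasure (volume.restrict (Icc (0 : ℝ) 1)) :=
  ⟨by simp⟩

instance isProbabilityMeasure_rnnMeasure (k : ℕ) (v : ℝ≥0) :
    IsProbabilityMeasure (rnnMeasure k v) := by
  unfold rnnMeasure
  infer_instance

/-- If all but few bias vectors satisfy a conditional bound, the bound holds up to that error. -/
theorem measure_prod_le_of_slice {α β : Type*} [MeasurableSpace α] [MeasurableSpace β]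
    (μ : Measure α) (ν : Measure β) [IsProbabilityMeasure μ] [IsProbabilityMeasure ν]
    {B : Set (α × β)} (hB : MeasurableSet B) {N : Set β} {c : ℝ≥0∞}
    (h : ∀ y ∉ N, μ ((fun x => (x, y)) ⁻¹' B) ≤ c) : (μ.prod ν) B ≤ c + ν N := by
  rw [Measure.prod_apply_symm hB]
  calc ∫⁻ y, μ ((fun x => (x, y)) ⁻¹' B) ∂ν
      ≤ ∫⁻ y, (c + N.indicator (fun _ => 1) y) ∂ν := by
        refine lintegral_mono fun y => ?_
        by_cases hy : y ∈ N
        · simp only [indicator_of_mem hy]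
          exact prob_le_one.trans le_add_self
        · simpa [hy] using h y hy
    _ ≤ c + ν N := by
        rw [lintegral_add_left measurable_const, lintegral_const, measure_univ, mul_one]
        gcongr
        exact (lintegral_indicator_const_le N 1).trans_eq (one_mul _)

/-- **High variance, chaos.** If `σ k → ∞`, then with weights i.i.d.
`N(0, σ_k² / k)` and biases i.i.d. `Uniform[0,1]`, the probability that the RNN
step map is Li-Yorke chaotic tends to `1` as `k → ∞`. -/
theorem high_variance_chaos (σ : ℕ → ℝ) (hσ : ∀ k, 0 < σ k)
    (hlim : Tendsto σ atTop atTop) :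
    Tendsto (fun k : ℕ =>
        rnnMeasure k (((σ k) ^ 2 / k).toNNReal)
          {p | LiYorkeChaotic (rnnStep p.1 p.2)})
      atTop (nhds 1) := by
  suffices hcompl : Tendsto (fun k : ℕ => rnnMeasure k (((σ k) ^ 2 / k).toNNReal)
      {p | LiYorkeChaotic (rnnStep p.1 p.2)}ᶜ) atTop (nhds 0) by
    have hsub : Tendsto (fun k : ℕ => 1 - rnnMeasure k (((σ k) ^ 2 / k).toNNReal)
        {p | LiYorkeChaotic (rnnStep p.1 p.2)}ᶜ) atTop (nhds (1 - 0)) :=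
      ENNReal.Tendsto.sub tendsto_const_nhds hcompl (Or.inl ENNReal.one_ne_top)
    rw [tsub_zero] at hsub
    refine tendsto_of_tendsto_of_tendsto_of_le_of_le hsub tendsto_const_nhds (fun k => ?_)
      fun k => prob_le_one
    rw [tsub_le_iff_right]
    refine le_trans ?_ (measure_union_le _ _)
    rw [union_compl_self, measure_univ]
  rw [ENNReal.tendsto_nhds_zero]
  intro ε hε
  have hε4 : 0 < ε / 4 := ENNReal.div_pos hε.ne' (by norm_num)
  obtain ⟨m, hm⟩ : ∃ m : ℕ, (3 / 4 : ℝ≥0∞) ^ m ≤ ε / 4 :=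
    ((ENNReal.tendsto_pow_atTop_nhds_zero_of_lt_one
      (by rw [ENNReal.div_lt_iff] <;> norm_num)).eventually (ge_mem_nhds hε4)).exists
  obtain ⟨η, hη, hη1, hηε⟩ : ∃ η : ℝ, 0 < η ∧ η ≤ 1 ∧ ENNReal.ofReal (6 * m * η) ≤ ε / 4 := by
    have h : Tendsto (fun η : ℝ => ENNReal.ofReal (6 * m * η)) (nhdsWithin 0 (Ioi 0)) (nhds 0) := by
      refine Tendsto.mono_left ?_ nhdsWithin_le_nhds
      have : Continuous fun η : ℝ => ENNReal.ofReal (6 * m * η) :=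
        ENNReal.continuous_ofReal.comp (by fun_prop)
      simpa using this.tendsto 0
    obtain ⟨η, h1, h2⟩ := ((h.eventually (ge_mem_nhds hε4)).and
      (Ioc_mem_nhdsGT (zero_lt_one' ℝ))).exists
    exact ⟨η, h2.1, h2.2, h1⟩
  obtain ⟨q, hq, hqη⟩ : ∃ q : ℝ, 0 < q ∧ 64 * q = η ^ 3 := ⟨η ^ 3 / 64, by positivity, by ring⟩
  have hq64 : 64 * q ≤ 1 := hqη.le.trans (pow_le_one₀ hη.le hη1)
  set U : Measure ℝ := volume.restrict (Icc 0 1)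
  have hpow : ∀ j, 0 < q ^ (j + 1) ∧ q ^ (j + 1) ≤ 1 ∧ 64 * q ^ (j + 2) ≤ q ^ (j + 1) := by
    intro j
    have h := pow_pos hq (j + 1)
    refine ⟨h, pow_le_one₀ hq.le (by linarith), ?_⟩
    rw [pow_succ q (j + 1)]
    nlinarith
  have hlow : ∀ j, U.real (Iic (q ^ (j + 2))) = q ^ (j + 2) := by
    intro j
    obtain ⟨h1, h2, -⟩ := hpow (j + 1)
    have : Iic (q ^ (j + 2)) ∩ Icc 0 1 = Icc 0 (q ^ (j + 2)) := by
      ext x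
      simp only [mem_inter_iff, mem_Iic, mem_Icc]
      exact ⟨fun h => ⟨h.2.1, h.1⟩, fun h => ⟨h.2, h.1, h.2.trans h2⟩⟩
    rw [measureReal_restrict_apply measurableSet_Iic, this,
      Real.volume_real_Icc_of_le h1.le, sub_zero]
  have hmid : ∀ j, U.real (Ioc (q ^ (j + 2)) (q ^ (j + 1) / 2)) = q ^ (j + 1) / 2 - q ^ (j + 2) := by
    intro j
    obtain ⟨h1, h2, h3⟩ := hpow j
    have h4 := (hpow (j + 1)).1
    have : Ioc (q ^ (j + 2)) (q ^ (j + 1) / 2) ⊆ Icc 0 1 :=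
      fun x hx => ⟨h4.le.trans hx.1.le, hx.2.trans (by linarith)⟩
    rw [measureReal_restrict_apply measurableSet_Ioc, inter_eq_left.2 this,
      Real.volume_real_Ioc_of_le (by linarith)]
  let D : Set ℝ → (k : ℕ) → Set (Fin k → ℝ) := fun I k =>
    {b | k * U.real I / 2 ≤ |∑ i, I.indicator (fun _ => (1 : ℝ)) (b i) - k * U.real I|}
  let N : (k : ℕ) → Set (Fin k → ℝ) := fun k => {b | ¬∀ i, 0 ≤ b i} ∪
    ⋃ j ∈ Finset.range (2 * m),
      (D (Iic (q ^ (j + 2))) k ∪ D (Ioc (q ^ (j + 2)) (q ^ (j + 1) / 2)) k)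
  have hneg : ∀ k, (Measure.pi fun _ : Fin k => U) {b | ¬∀ i, 0 ≤ b i} = 0 := by
    intro k
    change ∀ᵐ b ∂(Measure.pi fun _ : Fin k => U), ∀ i, 0 ≤ b i
    refine ae_all_iff.2 fun i => ?_
    have : ∀ᵐ x ∂U, 0 ≤ x := (ae_restrict_mem measurableSet_Icc).mono fun x hx => hx.1
    exact (Measure.quasiMeasurePreserving_eval (fun _ : Fin k => U) i).ae this
  have hN : Tendsto (fun k => (Measure.pi fun _ : Fin k => U) (N k)) atTop (nhds 0) := by
    have hsum : Tendsto (fun k => ∑ j ∈ Finset.range (2 * m),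
        ((Measure.pi fun _ : Fin k => U) (D (Iic (q ^ (j + 2))) k) +
          (Measure.pi fun _ : Fin k => U) (D (Ioc (q ^ (j + 2)) (q ^ (j + 1) / 2)) k)))
        atTop (nhds (∑ j ∈ Finset.range (2 * m), (0 + 0))) := by
      refine tendsto_finsetSum _ fun j _ => Tendsto.add ?_ ?_
      · exact tendsto_measure_count_deviation U measurableSet_Iic
          (by rw [hlow]; exact (hpow (j + 1)).1)
      · exact tendsto_measure_count_deviation U measurableSet_Ioc
          (by rw [hmid]; linarith [(hpow j).1, (hpow j).2.2])
    simp only [add_zero, Finset.sum_const_zero] at hsum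
    refine tendsto_of_tendsto_of_tendsto_of_le_of_le tendsto_const_nhds hsum
      (fun _ => zero_le) fun k => ?_
    refine (measure_union_le _ _).trans ?_
    rw [hneg, zero_add]
    exact (measure_biUnion_finset_le _ _).trans
      (Finset.sum_le_sum fun j _ => measure_union_le _ _)
  have hσbig : ∀ᶠ k in atTop, ∀ j ∈ Finset.range (2 * m),
      32 ≤ η ^ 2 * (σ k ^ 2 * (q ^ (j + 1)) ^ 3) := by
    rw [Filter.eventually_all_finset]
    intro j _
    have h : Tendsto (fun k => η ^ 2 * (σ k ^ 2 * (q ^ (j + 1)) ^ 3)) atTop atTop :=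
      (((tendsto_pow_atTop two_ne_zero).comp hlim).atTop_mul_const
        (pow_pos (hpow j).1 3)).const_mul_atTop (by positivity)
    exact h.eventually_ge_atTop 32
  filter_upwards [hσbig, hN.eventually (ge_mem_nhds hε4), eventually_gt_atTop 0]
    with k hσk hNk hk
  have hk' : (0 : ℝ) < k := by exact_mod_cast hk
  have hgood : ∀ b ∉ N k, (∀ i, 0 ≤ b i) ∧ ∀ j < 2 * m,
      ∑ i, (Iic (q ^ (j + 2))).indicator (fun _ => (1 : ℝ)) (b i) ≤ 2 * (k * q ^ (j + 2)) ∧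
      k * q ^ (j + 1) / 8
        ≤ ∑ i, (Ioc (q ^ (j + 2)) (q ^ (j + 1) / 2)).indicator (fun _ => (1 : ℝ)) (b i) := by
    intro b hb
    simp only [N, D, mem_union, mem_iUnion, mem_ofPred_eq, not_or, not_not, not_exists, not_le,
      Finset.mem_range, hlow, hmid] at hb
    refine ⟨hb.1, fun j hj => ?_⟩
    obtain ⟨h1, h2⟩ := hb.2 j hj
    rw [abs_lt] at h1 h2
    obtain ⟨h3, -, h4⟩ := hpow j
    have h5 := mul_pos hk' h3
    have h6 := mul_le_mul_of_nonneg_left h4 hk'.le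
    have h7 := mul_pos hk' (hpow (j + 1)).1
    constructor
    · linarith [h1.2]
    · linarith [h2.1]
  let B : Set ((Fin k → ℝ) × (Fin k → ℝ)) :=
    {p | ∀ l < m, ¬(1 ≤ ∑ i, p.1 i * max (q ^ (2 * l + 2) - p.2 i) 0 ∧
      ∑ i, p.1 i * max (q ^ (2 * l + 1) - p.2 i) 0 ≤ 0)}
  have hB : MeasurableSet B := by
    have hg : ∀ x : ℝ, Measurable fun p : (Fin k → ℝ) × (Fin k → ℝ) =>
        ∑ i, p.1 i * max (x - p.2 i) 0 := fun x => by fun_prop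
    simp only [B, ofPred_forall]
    exact MeasurableSet.iInter fun l => MeasurableSet.iInter fun _ =>
      ((measurableSet_le measurable_const (hg _)).inter
        (measurableSet_le (hg _) measurable_const)).compl
  have hsubset : {p : (Fin k → ℝ) × (Fin k → ℝ) | LiYorkeChaotic (rnnStep p.1 p.2)}ᶜ
      ⊆ univ ×ˢ N k ∪ B := by
    rintro ⟨a, b⟩ hp
    by_contra hcon
    simp only [mem_union, mem_prod, mem_univ, true_and, not_or, B, mem_ofPred_eq, not_forall,
      not_not] at hcon
    obtain ⟨hb, l, -, h1, h2⟩ := hcon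
    obtain ⟨h3, h4, h5⟩ := hpow (2 * l)
    have h6 := (hpow (2 * l + 1)).1
    refine hp (liYorkeChaotic_rnnStep (hgood b hb).1 h6.le ?_ ?_ h1 h2)
    · linarith
    · exact pow_lt_one₀ hq.le (by linarith) (by omega)
  calc rnnMeasure k _ _ ≤ rnnMeasure k _ (univ ×ˢ N k ∪ B) := measure_mono hsubset
    _ ≤ ε / 4 + ((ε / 4 + ε / 4) + ε / 4) := by
      refine (measure_union_le _ _).trans (add_le_add ?_ ?_)
      · rw [rnnMeasure, Measure.prod_prod, measure_univ, one_mul]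
        exact hNk
      · refine (measure_prod_le_of_slice _ _ hB (N := N k) fun b hb => ?_).trans
          (add_le_add (add_le_add hm hηε) hNk)
        exact measure_no_sign_change_le hk (hgood b hb).1 hη hη1 hq hqη.le m
          (fun j hj => hσk j (Finset.mem_range.2 hj)) (fun j hj => ((hgood b hb).2 j hj).1)
          fun j hj => ((hgood b hb).2 j hj).2
    _ = ε := by
      calc ε / 4 + ((ε / 4 + ε / 4) + ε / 4) = 4 * (ε / 4) := by ring
        _ = ε := ENNReal.mul_div_cancel (by norm_num) (by norm_num)
end

section
/- Let (v_k)_{k∈ℕ} be any sequence of positive reals with k·v_k → ∞ as k → ∞. For each k, let the weights a_1, …, a_k be i.i.d. Gaussian N(0, v_k) and the biases b_1, …, b_k be i.i.d. Uniform[0,1] independent of the weights. Then the probability that the RNN step map f_{a,b} has a point of period 3 tends to 1 as k → ∞. -/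
open MeasureTheory ProbabilityTheory Filter Set
open scoped NNReal ENNReal

/-- `f` has a point of period 3 in `[0,1]`. -/
def HasPeriod3 (f : ℝ → ℝ) : Prop :=
  ∃ x ∈ Set.Icc (0:ℝ) 1, f (f (f x)) = x ∧ f x ≠ x


/-- The law of `k` i.i.d. centred Gaussian weights of variance `v`. -/
noncomputable abbrev weightMeasure (k : ℕ) (v : ℝ≥0) : Measure (Fin k → ℝ) :=
  Measure.pi fun _ => gaussianReal 0 v

section GaussianCombination

variable {k : ℕ} {v : ℝ≥0}

lemma memLp_weight (i : Fin k) : MemLp (fun a : Fin k → ℝ => a i) 2 (weightMeasure k v) :=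
  (memLp_id_gaussianReal' (μ := 0) (v := v) 2 (by simp)).comp_measurePreserving
    (measurePreserving_eval (fun _ : Fin k => gaussianReal 0 v) i)

lemma iIndepFun_weight : iIndepFun (fun i (a : Fin k → ℝ) => a i) (weightMeasure k v) :=
  iIndepFun_pi (X := fun _ : Fin k => (id : ℝ → ℝ)) fun _ => aemeasurable_id

lemma covariance_weight (i j : Fin k) :
    cov[fun a : Fin k → ℝ => a i, fun a => a j; weightMeasure k v]
      = if i = j then (v : ℝ) else 0 := by
  split_ifs with h
  · subst h
    have hm := measurePreserving_eval (fun _ : Fin k => gaussianReal 0 v) i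
    rw [covariance_self (measurable_pi_apply i).aemeasurable]
    have := variance_map (μ := weightMeasure k v) (Y := fun a : Fin k → ℝ => a i)
      (X := (id : ℝ → ℝ)) aemeasurable_id (measurable_pi_apply i).aemeasurable
    rw [show (weightMeasure k v).map (fun a : Fin k → ℝ => a i) = gaussianReal 0 v from hm.map_eq,
      variance_id_gaussianReal] at this
    exact this.symm
  · exact (iIndepFun_weight.indepFun h).covariance_eq_zero (memLp_weight i) (memLp_weight j)

lemma memLp_weight_mul (c : ℝ) (i : Fin k) :
    MemLp (fun a : Fin k → ℝ => a i * c) 2 (weightMeasure k v) :=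
  (memLp_weight i).mul_const c

lemma covariance_combination (c d : Fin k → ℝ) :
    cov[fun a : Fin k → ℝ => ∑ i, a i * c i, fun a => ∑ i, a i * d i; weightMeasure k v]
      = v * ∑ i, c i * d i := by
  rw [covariance_fun_sum_fun_sum (fun i => memLp_weight_mul _ i) (fun i => memLp_weight_mul _ i),
    Finset.mul_sum]
  simp only [covariance_mul_const_left, covariance_mul_const_right, covariance_weight, ite_mul,
    zero_mul, Finset.sum_ite_eq, Finset.mem_univ, if_true]
  exact Finset.sum_congr rfl fun i _ => by ring

lemma integral_combination (c : Fin k → ℝ) :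
    ∫ a, ∑ i, a i * c i ∂(weightMeasure k v) = 0 := by
  rw [integral_finsetSum _ fun i _ => (memLp_weight_mul (c i) i).integrable (by norm_num)]
  simp [integral_mul_const, integral_eval]

lemma hasGaussianLaw_combinations {ι : Type*} [Finite ι] (c : ι → Fin k → ℝ) :
    HasGaussianLaw (fun (a : Fin k → ℝ) (j : ι) => ∑ i, a i * c j i) (weightMeasure k v) := by
  have := Fintype.ofFinite ι
  have h : HasGaussianLaw (fun (a : Fin k → ℝ) (i : Fin k) => a i) (weightMeasure k v) := by
    refine iIndepFun_weight.hasGaussianLaw fun i => ⟨?_⟩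
    rw [show (weightMeasure k v).map (fun a : Fin k → ℝ => a i) = gaussianReal 0 v from
      (measurePreserving_eval (fun _ : Fin k => gaussianReal 0 v) i).map_eq]
    infer_instance
  have h' := h.map_fun (ContinuousLinearMap.pi fun j =>
    ∑ i, (c j i) • ContinuousLinearMap.proj (R := ℝ) (φ := fun _ : Fin k => ℝ) i)
  convert! h' using 3
  simp [mul_comm]

lemma map_combination (c : Fin k → ℝ) :
    (weightMeasure k v).map (fun a => ∑ i, a i * c i)
      = gaussianReal 0 (v * ∑ i, c i ^ 2).toNNReal := by
  have h := (hasGaussianLaw_combinations (v := v) (fun _ : Unit => c)).map_fun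
    (ContinuousLinearMap.proj (R := ℝ) (φ := fun _ : Unit => ℝ) ())
  have h' := h.map_eq_gaussianReal
  simp only [ContinuousLinearMap.proj_apply] at h'
  rw [h', integral_combination, ← covariance_self (Measurable.aemeasurable (by fun_prop)),
    covariance_combination]
  simp [sq]

/-- Linear combinations of the weights with disjoint supports are independent. -/
lemma iIndepFun_combinations {ι : Type*} [Finite ι] (c : ι → Fin k → ℝ)
    (hc : ∀ j l, j ≠ l → ∀ i, c j i * c l i = 0) :
    iIndepFun (fun j (a : Fin k → ℝ) => ∑ i, a i * c j i) (weightMeasure k v) := by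
  refine (hasGaussianLaw_combinations c).iIndepFun_of_covariance_eq_zero fun j l hjl => ?_
  rw [covariance_combination]
  simp [hc j l hjl]

lemma gaussianReal_abs_le_le {w : ℝ≥0} {t e : ℝ} (ht : 0 < t) (he : 0 ≤ e)
    (h : t ^ 2 ≤ e ^ 2 * w) :
    gaussianReal 0 w {x | |x| ≤ t} ≤ ENNReal.ofReal e := by
  have hw : w ≠ 0 := by
    rintro rfl
    simp at h
    nlinarith
  have hw' : (0 : ℝ) < w := by positivity
  rw [gaussianReal_apply _ hw]
  have hpdf : ∀ x, gaussianPDF 0 w x ≤ ENNReal.ofReal (√(2 * Real.pi * w))⁻¹ := fun x => by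
    refine ENNReal.ofReal_le_ofReal ?_
    rw [gaussianPDFReal]
    refine mul_le_of_le_one_right (by positivity) (Real.exp_le_one_iff.2 ?_)
    rw [neg_div]
    exact neg_nonpos.2 (by positivity)
  have hset : {x : ℝ | |x| ≤ t} = Icc (-t) t := by
    ext x
    simp [abs_le]
  refine (setLIntegral_mono' (by rw [hset]; exact measurableSet_Icc) fun x _ => hpdf x).trans ?_
  rw [setLIntegral_const, hset, Real.volume_Icc, ← ENNReal.ofReal_mul (by positivity)]
  refine ENNReal.ofReal_le_ofReal ?_
  rw [inv_mul_le_iff₀ (by positivity)]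
  refine le_of_sq_le_sq ?_ (by positivity)
  rw [mul_pow, Real.sq_sqrt (by positivity)]
  have h3 := Real.pi_gt_three
  nlinarith [mul_nonneg (sq_nonneg e) hw'.le]

lemma weightMeasure_abs_combination_le {c : Fin k → ℝ} {t e : ℝ} (ht : 0 < t) (he : 0 ≤ e)
    (h : t ^ 2 ≤ e ^ 2 * (v * ∑ i, c i ^ 2)) :
    weightMeasure k v {a | |∑ i, a i * c i| ≤ t} ≤ ENNReal.ofReal e := by
  have hm : MeasurableSet {x : ℝ | |x| ≤ t} := measurableSet_le (by fun_prop) (by fun_prop)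
  have := gaussianReal_abs_le_le (w := (v * ∑ i, c i ^ 2).toNNReal) ht he
    (by rwa [Real.coe_toNNReal _ (by positivity)])
  rwa [← map_combination, Measure.map_apply (by fun_prop) hm] at this

lemma weightMeasure_le_abs_combination {c : Fin k → ℝ} {t e : ℝ} (ht : 0 < t)
    (h : v * ∑ i, c i ^ 2 ≤ e * t ^ 2) :
    weightMeasure k v {a | t ≤ |∑ i, a i * c i|} ≤ ENNReal.ofReal e := by
  have hL : MemLp (fun a : Fin k → ℝ => ∑ i, a i * c i) 2 (weightMeasure k v) :=
    memLp_finsetSum _ fun i _ => memLp_weight_mul (c i) i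
  have := meas_ge_le_variance_div_sq hL ht
  rw [integral_combination, ← covariance_self (Measurable.aemeasurable (by fun_prop)),
    covariance_combination] at this
  simp only [sub_zero] at this
  refine this.trans (ENNReal.ofReal_le_ofReal ?_)
  rw [div_le_iff₀ (by positivity)]
  simpa [sq] using h

lemma gaussianReal_Ici {w : ℝ≥0} (hw : w ≠ 0) : gaussianReal 0 w (Ici 0) ≤ 2⁻¹ := by
  have := nullSingletonClass_gaussianReal (μ := 0) hw
  have h1 : gaussianReal 0 w (Ici 0) = gaussianReal 0 w (Iic 0) := by
    conv_lhs => rw [← neg_zero, ← gaussianReal_map_neg]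
    rw [Measure.map_apply (by fun_prop) measurableSet_Ici]
    congr 1
    ext x
    simp
  have h2 := measure_add_measure_compl (μ := gaussianReal 0 w) (measurableSet_Ici (a := (0 : ℝ)))
  rw [compl_Ici, measure_congr Iio_ae_eq_Iic, ← h1, measure_univ, ← two_mul] at h2
  exact (ENNReal.eq_inv_of_mul_eq_one_left (by rw [mul_comm]; exact h2)).le

lemma gaussianReal_Iic {w : ℝ≥0} (hw : w ≠ 0) : gaussianReal 0 w (Iic 0) ≤ 2⁻¹ := by
  refine le_trans (le_of_eq ?_) (gaussianReal_Ici hw)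
  conv_rhs => rw [← neg_zero, ← gaussianReal_map_neg]
  rw [Measure.map_apply (by fun_prop) measurableSet_Ici]
  congr 1
  ext x
  simp

/-- A sign sequence of independent symmetric variables avoiding the pattern `-` before `+`
has one of `n + 1` threshold shapes. -/
lemma weightMeasure_monotone_signs_le {n : ℕ} (c : Fin n → Fin k → ℝ)
    (hc : ∀ j l, j ≠ l → ∀ i, c j i * c l i = 0) (hpos : ∀ j, 0 < v * ∑ i, c j i ^ 2) :
    weightMeasure k v {a | ∀ j l, j < l → ¬ (∑ i, a i * c j i < 0 ∧ 0 < ∑ i, a i * c l i)}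
      ≤ ENNReal.ofReal ((n + 1) * 2⁻¹ ^ n) := by
  set S : ℕ → Fin n → Set ℝ := fun r j => if (j : ℕ) < r then Ici 0 else Iic 0
  have hS : ∀ r j, MeasurableSet (S r j) := fun r j => by
    simp only [S]; split_ifs; exacts [measurableSet_Ici, measurableSet_Iic]
  have hsub : {a : Fin k → ℝ | ∀ j l, j < l → ¬ (∑ i, a i * c j i < 0 ∧ 0 < ∑ i, a i * c l i)}
      ⊆ ⋃ r ∈ Finset.range (n + 1), ⋂ j, (fun a => ∑ i, a i * c j i) ⁻¹' S r j := by
    intro a ha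
    simp only [mem_iUnion, mem_iInter, Finset.mem_range, mem_preimage]
    by_cases hneg : ∃ j : ℕ, ∃ h : j < n, ∑ i, a i * c ⟨j, h⟩ i < 0
    · classical
      obtain ⟨hr, hr'⟩ := Nat.find_spec hneg
      refine ⟨Nat.find hneg, by omega, fun j => ?_⟩
      simp only [S]
      split_ifs with hj
      · by_contra hcon
        exact Nat.find_min hneg hj ⟨j.2, by simpa using hcon⟩
      · rcases (not_lt.1 hj).eq_or_lt with heq | hlt
        · have : j = ⟨Nat.find hneg, hr⟩ := Fin.ext heq.symm
          rw [this]
          exact hr'.le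
        · by_contra hcon
          exact ha ⟨_, hr⟩ j hlt ⟨hr', by simpa using hcon⟩
    · refine ⟨n, by omega, fun j => ?_⟩
      simp only [S, j.2, if_true]
      by_contra hcon
      exact hneg ⟨j, j.2, by simpa using hcon⟩
  have hterm : ∀ r, weightMeasure k v (⋂ j, (fun a => ∑ i, a i * c j i) ⁻¹' S r j)
      ≤ ENNReal.ofReal (2⁻¹ ^ n) := fun r => by
    rw [(iIndepFun_combinations c hc).meas_iInter fun j => ⟨S r j, hS r j, rfl⟩]
    calc ∏ j, weightMeasure k v ((fun a => ∑ i, a i * c j i) ⁻¹' S r j)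
        ≤ ∏ _j : Fin n, (2⁻¹ : ℝ≥0∞) := by
          refine Finset.prod_le_prod' fun j _ => ?_
          rw [← Measure.map_apply (by fun_prop) (hS r j), map_combination]
          have : (v * ∑ i, c j i ^ 2).toNNReal ≠ 0 := by simpa using hpos j
          simp only [S]
          split_ifs
          exacts [gaussianReal_Ici this, gaussianReal_Iic this]
      _ = ENNReal.ofReal (2⁻¹ ^ n) := by
          rw [ENNReal.ofReal_pow (by norm_num), ENNReal.ofReal_inv_of_pos (by norm_num)]
          simp
  calc _ ≤ _ := measure_mono hsub
    _ ≤ ∑ r ∈ Finset.range (n + 1), weightMeasure k v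
          (⋂ j, (fun a => ∑ i, a i * c j i) ⁻¹' S r j) := measure_biUnion_finset_le _ _
    _ ≤ ∑ _r ∈ Finset.range (n + 1), ENNReal.ofReal (2⁻¹ ^ n) :=
        Finset.sum_le_sum fun r _ => hterm r
    _ = _ := by
      rw [Finset.sum_const, Finset.card_range, nsmul_eq_mul, ENNReal.ofReal_mul (by positivity)]
      congr 1
      rw [← Nat.cast_succ, ENNReal.ofReal_natCast]

/-- If the combinations `c j` have disjoint supports and dominate the perturbations `d j`,
then with high probability some perturbed sum is nonpositive and a later one is at least `1`. -/
lemma weightMeasure_no_sign_change_le {n : ℕ} (c d : Fin n → Fin k → ℝ)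
    (hc : ∀ j l, j ≠ l → ∀ i, c j i * c l i = 0) {T : Fin n → ℝ} {e δ : ℝ} (he : 0 ≤ e)
    (hδ : 0 ≤ δ) (hT : ∀ j, 1 ≤ T j)
    (hcT : ∀ j, (2 * T j) ^ 2 ≤ e ^ 2 * (v * ∑ i, c j i ^ 2))
    (hdT : ∀ j, v * ∑ i, d j i ^ 2 ≤ δ * T j ^ 2) :
    weightMeasure k v {a | ¬ ∃ j l, j < l ∧ ∑ i, a i * (c j i + d j i) ≤ 0 ∧
        1 ≤ ∑ i, a i * (c l i + d l i)}
      ≤ ENNReal.ofReal ((n + 1) * 2⁻¹ ^ n + n * e + n * δ) := by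
  set A := {a : Fin k → ℝ | ∀ j l, j < l → ¬ (∑ i, a i * c j i < 0 ∧ 0 < ∑ i, a i * c l i)}
  have hsub : {a : Fin k → ℝ | ¬ ∃ j l, j < l ∧ ∑ i, a i * (c j i + d j i) ≤ 0 ∧
        1 ≤ ∑ i, a i * (c l i + d l i)} ⊆
      (A ∪ ⋃ j, {a | |∑ i, a i * c j i| ≤ 2 * T j}) ∪ ⋃ j, {a | T j ≤ |∑ i, a i * d j i|} := by
    intro a ha
    by_contra hcon
    simp only [mem_union, mem_iUnion, mem_ofPred_eq, not_or, not_exists, not_le, A] at hcon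
    obtain ⟨⟨hA, hC⟩, hD⟩ := hcon
    push Not at hA
    obtain ⟨j, l, hjl, hj, hl⟩ := hA
    refine ha ⟨j, l, hjl, ?_, ?_⟩
    · have h1 := hC j
      have h2 := (abs_lt.1 (hD j)).2
      rw [abs_of_neg hj] at h1
      simp only [mul_add, Finset.sum_add_distrib]
      linarith [hT j]
    · have h1 := hC l
      have h2 := (abs_lt.1 (hD l)).1
      rw [abs_of_pos hl] at h1
      simp only [mul_add, Finset.sum_add_distrib]
      linarith [hT l]
  have hpos : ∀ j, 0 < v * ∑ i, c j i ^ 2 := fun j => by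
    by_contra hcon
    have h0 : 0 ≤ e ^ 2 := sq_nonneg e
    nlinarith [hT j, hcT j, mul_nonneg h0 (neg_nonneg.2 (not_lt.1 hcon))]
  have hunion : ∀ (s : Fin n → Set (Fin k → ℝ)) (x : ℝ), 0 ≤ x →
      (∀ j, weightMeasure k v (s j) ≤ ENNReal.ofReal x) →
      weightMeasure k v (⋃ j, s j) ≤ ENNReal.ofReal (n * x) := fun s x hx hs => by
    refine (measure_iUnion_fintype_le _ _).trans ((Finset.sum_le_sum fun j _ => hs j).trans ?_)
    rw [ENNReal.ofReal_mul (by positivity)]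
    simp
  rw [ENNReal.ofReal_add (by positivity) (by positivity),
    ENNReal.ofReal_add (by positivity) (by positivity)]
  refine (measure_mono hsub).trans ((measure_union_le _ _).trans (add_le_add
    ((measure_union_le _ _).trans (add_le_add ?_ ?_)) ?_))
  · exact weightMeasure_monotone_signs_le c hc hpos
  · exact hunion _ _ he fun j =>
      weightMeasure_abs_combination_le (by linarith [hT j]) he (hcT j)
  · exact hunion _ _ hδ fun j =>
      weightMeasure_le_abs_combination (by linarith [hT j]) (hdT j)

end GaussianCombination

/-- A continuous self-map of `[0,1]` with `f 0 = 0`, `f p = 1` and `f q = 0` for some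
`p < q` has a point of period three. -/
lemma HasPeriod3.of_continuous {f : ℝ → ℝ} (hf : Continuous f)
    (h0 : f 0 = 0) {p q : ℝ} (hp : 0 ≤ p) (hpq : p < q) (hq : q ≤ 1) (hfp : f p = 1)
    (hfq : f q = 0) : HasPeriod3 f := by
  have hcl : IsClosed {x | x ∈ Icc 0 p ∧ f x ≤ x} :=
    isClosed_Icc.inter (isClosed_le hf continuous_id)
  have hcpt : IsCompact {x | x ∈ Icc 0 p ∧ f x ≤ x} :=
    isCompact_Icc.of_isClosed_subset hcl fun x hx => hx.1
  obtain ⟨m, ⟨⟨hm0, hmp⟩, hfm⟩, hmax⟩ := hcpt.exists_isGreatest ⟨0, ⟨le_rfl, hp⟩, h0.le⟩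
  have hmp' : m < p := hmp.lt_of_ne fun h => by rw [h, hfp] at hfm; linarith
  have habove : ∀ x, m < x → x ≤ p → x < f x := fun x hx hxp => by
    by_contra hcon
    exact absurd (hmax ⟨⟨hm0.trans hx.le, hxp⟩, not_lt.1 hcon⟩) (not_le.2 hx)
  have hcov : ∀ y, m < y → y ≤ 1 → ∃ x, m < x ∧ x ≤ p ∧ f x = y := fun y hy hy1 => by
    obtain ⟨x, hx, rfl⟩ := intermediate_value_Icc hmp hf.continuousOn
      (show y ∈ Icc (f m) (f p) from ⟨hfm.trans hy.le, by rwa [hfp]⟩)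
    refine ⟨x, hx.1.lt_of_ne ?_, hx.2, rfl⟩
    rintro rfl
    linarith
  obtain ⟨u, hmu, hup, hfu⟩ := hcov q (by linarith) hq
  obtain ⟨y, hy, hfy⟩ := intermediate_value_Icc' hpq.le hf.continuousOn
    (show p ∈ Icc (f q) (f p) from ⟨by rwa [hfq], by rw [hfp]; linarith⟩)
  obtain ⟨w, hmw, hwp, hfw⟩ := hcov y (by linarith [hy.1]) (by linarith [hy.2])
  obtain ⟨x, hx, hfx⟩ := intermediate_value_uIcc (a := u) (b := w)
    (f := fun x => f (f (f x)) - x) (by fun_prop)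
    (show (0 : ℝ) ∈ _ from mem_uIcc.2 (Or.inl ⟨by simp only [hfu, hfq, h0]; linarith,
      by simp only [hfw, hfy, hfp]; linarith⟩))
  have hmx : m < x := (lt_min hmu hmw).trans_le hx.1
  have hxp : x ≤ p := hx.2.trans (max_le hup hwp)
  exact ⟨x, ⟨by linarith, by linarith⟩, sub_eq_zero.1 hfx, (habove x hmx hxp).ne'⟩

lemma continuous_clip : Continuous clip := by
  unfold clip
  fun_prop

lemma hasPeriod3_rnnStep {k : ℕ} {a b : Fin k → ℝ} (hb : ∀ i, 0 ≤ b i) {p q : ℝ} (hp : 0 ≤ p)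
    (hpq : p < q) (hq : q ≤ 1) (hfp : 1 ≤ ∑ i, a i * max (p - b i) 0)
    (hfq : ∑ i, a i * max (q - b i) 0 ≤ 0) : HasPeriod3 (rnnStep a b) := by
  refine HasPeriod3.of_continuous (continuous_clip.comp (by fun_prop)) ?_ hp hpq hq
    ?_ ?_
  · simp [rnnStep, clip, hb]
  · simp [rnnStep, clip, hfp]
  · simp [rnnStep, clip, hfq]

section Biases

/-- Concentration of the number of samples falling in a set. -/
lemma measure_pi_count_deviation_le {U : Measure ℝ} [IsProbabilityMeasure U] {S : Set ℝ}
    (hS : MeasurableSet S) {p : ℝ} (hp : U.real S = p) (hp0 : 0 < p) {k : ℕ} (hk : 0 < k) :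
    Measure.pi (fun _ : Fin k => U) {b | k * p / 2 ≤ |∑ i, S.indicator 1 (b i) - k * p|}
      ≤ ENNReal.ofReal (1 / (k * p ^ 2)) := by
  have hk' : (0 : ℝ) < k := by exact_mod_cast hk
  have hm : Measurable (S.indicator (1 : ℝ → ℝ)) := measurable_one.indicator hS
  have hbd : ∀ x, S.indicator (1 : ℝ → ℝ) x ∈ Icc (0 : ℝ) 1 := fun x => by
    by_cases hx : x ∈ S <;> simp [hx]
  have hL : MemLp (S.indicator (1 : ℝ → ℝ)) 2 U :=
    MemLp.of_bound hm.aestronglyMeasurable 1 (ae_of_all _ fun x => by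
      rw [Real.norm_eq_abs, abs_of_nonneg (hbd x).1]; exact (hbd x).2)
  have hLi : ∀ i : Fin k, MemLp (fun b : Fin k → ℝ => S.indicator (1 : ℝ → ℝ) (b i)) 2
      (Measure.pi fun _ : Fin k => U) := fun i =>
    hL.comp_measurePreserving (measurePreserving_eval (fun _ : Fin k => U) i)
  have hsum : MemLp (fun b : Fin k → ℝ => ∑ i, S.indicator (1 : ℝ → ℝ) (b i)) 2
      (Measure.pi fun _ : Fin k => U) := memLp_finsetSum _ fun i _ => hLi i
  have hmean : ∫ b, ∑ i, S.indicator (1 : ℝ → ℝ) (b i) ∂(Measure.pi fun _ : Fin k => U)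
      = k * p := by
    rw [integral_finsetSum _ fun i _ => (hLi i).integrable (by norm_num)]
    have : ∀ i : Fin k, ∫ b, S.indicator (1 : ℝ → ℝ) (b i) ∂(Measure.pi fun _ : Fin k => U) = p := by
      intro i
      rw [integral_comp_eval (μ := fun _ : Fin k => U) (i := i) hm.aestronglyMeasurable,
        integral_indicator_one hS, hp]
    simp [this]
  have hvar : Var[fun b : Fin k → ℝ => ∑ i, S.indicator (1 : ℝ → ℝ) (b i);
      Measure.pi fun _ : Fin k => U] ≤ k * (1 / 4) := by
    have h := variance_sum_pi (μ := fun _ : Fin k => U) (X := fun _ => S.indicator (1 : ℝ → ℝ))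
      fun _ => hL
    have h1 : Var[S.indicator (1 : ℝ → ℝ); U] ≤ 1 / 4 :=
      (variance_le_sq_of_bounded (ae_of_all _ hbd) hm.aemeasurable).trans (by norm_num)
    have h2 : (∑ i : Fin k, fun b : Fin k → ℝ => S.indicator (1 : ℝ → ℝ) (b i))
        = fun b => ∑ i, S.indicator (1 : ℝ → ℝ) (b i) := by
      ext b
      simp
    rw [h2] at h
    rw [h, Finset.sum_const, Finset.card_univ, Fintype.card_fin, nsmul_eq_mul]
    gcongr
  have h := meas_ge_le_variance_div_sq hsum (c := k * p / 2) (by positivity)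
  rw [hmean] at h
  refine h.trans (ENNReal.ofReal_le_ofReal ?_)
  rw [div_le_div_iff₀ (by positivity) (by positivity)]
  have h3 : (0 : ℝ) ≤ k * p ^ 2 := by positivity
  nlinarith [mul_le_mul_of_nonneg_right hvar h3]

/-- The uniform distribution on `[0,1]`. -/
noncomputable abbrev uniformUnit : Measure ℝ := volume.restrict (Icc (0 : ℝ) 1)

instance : IsProbabilityMeasure uniformUnit := ⟨by simp⟩

/-- Biases are well spread at the scales `ρ ^ j`, `j < n`. -/
structure WellSpread {k : ℕ} (n : ℕ) (ρ : ℝ) (b : Fin k → ℝ) : Prop where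
  nonneg : ∀ i, 0 ≤ b i
  le_count : ∀ j < n, k * ρ ^ j / 8 ≤ ∑ i, (Ioc (ρ ^ j / 4) (ρ ^ j / 2)).indicator (1 : ℝ → ℝ) (b i)
  count_le : ∀ j < n, ∑ i, (Icc 0 (ρ ^ (j + 1))).indicator (1 : ℝ → ℝ) (b i)
    ≤ 3 / 2 * (k * ρ ^ (j + 1))

lemma measure_not_wellSpread_le {k n : ℕ} (hk : 0 < k) {ρ : ℝ} (hρ : 0 < ρ) (hρ4 : ρ ≤ 1 / 4) :
    Measure.pi (fun _ : Fin k => uniformUnit) {b | ¬ WellSpread n ρ b}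
      ≤ ENNReal.ofReal (n * (2 / (k * (ρ ^ n) ^ 2))) := by
  have hk' : (0 : ℝ) < k := by exact_mod_cast hk
  set ν := Measure.pi (fun _ : Fin k => uniformUnit)
  set A : ℕ → Set (Fin k → ℝ) := fun j => {b | k * (ρ ^ j / 4) / 2 ≤
    |∑ i, (Ioc (ρ ^ j / 4) (ρ ^ j / 2)).indicator 1 (b i) - k * (ρ ^ j / 4)|}
  set B : ℕ → Set (Fin k → ℝ) := fun j => {b | k * ρ ^ (j + 1) / 2 ≤
    |∑ i, (Icc 0 (ρ ^ (j + 1))).indicator 1 (b i) - k * ρ ^ (j + 1)|}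
  have hpow : ∀ j : ℕ, ρ ^ j ≤ 1 := fun j => pow_le_one₀ hρ.le (by linarith)
  have hsub : {b | ¬ WellSpread n ρ b} ⊆
      {b | ¬ ∀ i, 0 ≤ b i} ∪ ⋃ j ∈ Finset.range n, (A j ∪ B j) := by
    intro b hb
    by_contra hcon
    simp only [mem_union, mem_iUnion, Finset.mem_range, mem_ofPred_eq, not_or, not_exists,
      not_not, A, B, not_le] at hcon
    refine hb ⟨hcon.1, fun j hj => ?_, fun j hj => ?_⟩
    · have := (abs_lt.1 (hcon.2 j hj).1).1
      linarith
    · have := (abs_lt.1 (hcon.2 j hj).2).2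
      linarith
  have hnull : ν {b | ¬ ∀ i, 0 ≤ b i} = 0 := by
    rw [← ae_iff, ae_all_iff]
    intro i
    have h : ∀ᵐ x ∂uniformUnit, 0 ≤ x :=
      (ae_restrict_mem measurableSet_Icc).mono fun x hx => hx.1
    exact (measurePreserving_eval (fun _ : Fin k => uniformUnit) i).quasiMeasurePreserving.ae h
  have hle : ∀ j < n, ∀ p : ℝ, ρ ^ n ≤ p →
      ENNReal.ofReal (1 / (k * p ^ 2)) ≤ ENNReal.ofReal (1 / (k * (ρ ^ n) ^ 2)) := fun j _ p hp =>
    ENNReal.ofReal_le_ofReal (by gcongr)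
  have hj1 : ∀ j < n, ρ ^ n ≤ ρ ^ (j + 1) := fun j hj =>
    pow_le_pow_of_le_one hρ.le (by linarith) hj
  have hAB : ∀ j < n, ν (A j ∪ B j) ≤ ENNReal.ofReal (2 / (k * (ρ ^ n) ^ 2)) := fun j hj => by
    have hxj : 0 < ρ ^ j := by positivity
    have hA : uniformUnit.real (Ioc (ρ ^ j / 4) (ρ ^ j / 2)) = ρ ^ j / 4 := by
      rw [measureReal_restrict_apply measurableSet_Ioc, inter_eq_left.2, Real.volume_real_Ioc_of_le]
      · ring
      · linarith
      · exact fun x hx => ⟨by linarith [hx.1], by linarith [hx.2, hpow j]⟩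
    have hB : uniformUnit.real (Icc 0 (ρ ^ (j + 1))) = ρ ^ (j + 1) := by
      rw [measureReal_restrict_apply measurableSet_Icc, inter_eq_left.2, Real.volume_real_Icc_of_le]
      · ring
      · positivity
      · exact Icc_subset_Icc_right (hpow _)
    calc ν (A j ∪ B j) ≤ ν (A j) + ν (B j) := measure_union_le _ _
      _ ≤ ENNReal.ofReal (1 / (k * (ρ ^ n) ^ 2)) + ENNReal.ofReal (1 / (k * (ρ ^ n) ^ 2)) := by
        refine add_le_add
          ((measure_pi_count_deviation_le measurableSet_Ioc hA (by positivity) hk).trans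
            (hle j hj _ ((hj1 j hj).trans ?_)))
          ((measure_pi_count_deviation_le measurableSet_Icc hB (by positivity) hk).trans
            (hle j hj _ (hj1 j hj)))
        rw [pow_succ]
        nlinarith
      _ = _ := by
        rw [← ENNReal.ofReal_add (by positivity) (by positivity)]
        congr 1
        ring
  calc ν {b | ¬ WellSpread n ρ b}
      ≤ ν {b | ¬ ∀ i, 0 ≤ b i} + ν (⋃ j ∈ Finset.range n, (A j ∪ B j)) :=
        (measure_mono hsub).trans (measure_union_le _ _)
    _ ≤ 0 + ∑ j ∈ Finset.range n, ν (A j ∪ B j) :=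
        add_le_add hnull.le (measure_biUnion_finset_le _ _)
    _ ≤ ∑ _j ∈ Finset.range n, ENNReal.ofReal (2 / (k * (ρ ^ n) ^ 2)) := by
        rw [zero_add]
        exact Finset.sum_le_sum fun j hj => hAB j (Finset.mem_range.1 hj)
    _ = _ := by
        rw [Finset.sum_const, Finset.card_range, nsmul_eq_mul,
          ENNReal.ofReal_mul (by positivity), ENNReal.ofReal_natCast]

end Biases

/-- The pre-activation is at least `1` at some point `ρ ^ l` and nonpositive at a larger point
`ρ ^ j`, where `j < l < n`. -/
def SignChange {k : ℕ} (n : ℕ) (ρ : ℝ) (a b : Fin k → ℝ) : Prop :=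
  ∃ j l : Fin n, j < l ∧ ∑ i, a i * max (ρ ^ (j : ℕ) - b i) 0 ≤ 0 ∧
    1 ≤ ∑ i, a i * max (ρ ^ (l : ℕ) - b i) 0

lemma SignChange.hasPeriod3 {k n : ℕ} {ρ : ℝ} (hρ : 0 < ρ) (hρ1 : ρ < 1) {a b : Fin k → ℝ}
    (hb : ∀ i, 0 ≤ b i) (h : SignChange n ρ a b) : HasPeriod3 (rnnStep a b) := by
  obtain ⟨j, l, hjl, hj, hl⟩ := h
  exact hasPeriod3_rnnStep hb (by positivity) (pow_lt_pow_right_of_lt_one₀ hρ hρ1 hjl)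
    (pow_le_one₀ hρ.le hρ1.le) hl hj

lemma measurableSet_signChange {k n : ℕ} {ρ : ℝ} :
    MeasurableSet {x : (Fin k → ℝ) × (Fin k → ℝ) | SignChange n ρ x.1 x.2} := by
  have : {x : (Fin k → ℝ) × (Fin k → ℝ) | SignChange n ρ x.1 x.2} =
      ⋃ (j : Fin n) (l : Fin n) (_ : j < l),
        {x | ∑ i, x.1 i * max (ρ ^ (j : ℕ) - x.2 i) 0 ≤ 0} ∩
        {x | 1 ≤ ∑ i, x.1 i * max (ρ ^ (l : ℕ) - x.2 i) 0} := by
    ext x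
    simp only [SignChange, mem_ofPred_eq, mem_iUnion, mem_inter_iff, exists_prop]
  rw [this]
  refine MeasurableSet.iUnion fun j => MeasurableSet.iUnion fun l => MeasurableSet.iUnion fun _ =>
    (measurableSet_le ?_ ?_).inter (measurableSet_le ?_ ?_) <;> fun_prop

lemma weightMeasure_not_signChange_le {k n : ℕ} {v : ℝ≥0} {ρ e : ℝ} (hρ : 0 < ρ)
    (hρ4 : ρ ≤ 1 / 4) (he : 0 < e) (hscale : 144 ≤ e ^ 2 * (k * v * (ρ ^ n) ^ 3))
    {b : Fin k → ℝ} (hb : WellSpread n ρ b) :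
    weightMeasure k v {a | ¬ SignChange n ρ a b}
      ≤ ENNReal.ofReal ((n + 1) * 2⁻¹ ^ n + n * e + n * (216 * ρ / e ^ 2)) := by
  set x : Fin n → ℝ := fun j => ρ ^ (j : ℕ)
  have hx0 : ∀ j, 0 < x j := fun j => by positivity
  have hxs : ∀ j : Fin n, ρ ^ ((j : ℕ) + 1) = ρ * x j := fun j => pow_succ' _ _
  set c : Fin n → Fin k → ℝ := fun j i => if ρ * x j < b i then max (x j - b i) 0 else 0
  set d : Fin n → Fin k → ℝ := fun j i => if ρ * x j < b i then 0 else max (x j - b i) 0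
  set T : Fin n → ℝ := fun j => e / 12 * √(k * v * x j ^ 3)
  have hT2 : ∀ j, T j ^ 2 = e ^ 2 / 144 * (k * v * x j ^ 3) := fun j => by
    have := hx0 j
    simp only [T]
    rw [mul_pow, Real.sq_sqrt (by positivity)]
    ring
  have hcd : ∀ j i, c j i + d j i = max (x j - b i) 0 := fun j i => by
    simp only [c, d]
    split_ifs <;> simp
  have hdisj : ∀ j l : Fin n, j < l → ∀ i, c j i * c l i = 0 := fun j l hjl i => by
    simp only [c]
    split_ifs with h1 h2
    · have : x l ≤ ρ * x j := by
        rw [← hxs]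
        exact pow_le_pow_of_le_one hρ.le (by linarith) hjl
      rw [max_eq_right (by linarith : x l - b i ≤ 0), mul_zero]
    all_goals simp
  have hmain := weightMeasure_no_sign_change_le (v := v) c d
    (fun j l hjl i => hjl.lt_or_gt.elim (fun h => hdisj j l h i)
      fun h => by rw [mul_comm]; exact hdisj l j h i) (T := T) he.le
    (by positivity : 0 ≤ 216 * ρ / e ^ 2) (fun j => ?_) (fun j => ?_) fun j => ?_
  · simp only [hcd] at hmain
    exact hmain
  · have hxn : ρ ^ n ≤ x j := pow_le_pow_of_le_one hρ.le (by linarith) j.2.le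
    have h0 : 0 ≤ T j := by positivity
    refine (one_le_sq_iff₀ h0).1 ?_
    rw [hT2]
    have : k * v * (ρ ^ n) ^ 3 ≤ k * v * x j ^ 3 := by gcongr
    nlinarith [mul_le_mul_of_nonneg_left this (sq_nonneg e)]
  · have hterm : ∀ i, (x j / 2) ^ 2 * (Ioc (x j / 4) (x j / 2)).indicator (1 : ℝ → ℝ) (b i)
        ≤ c j i ^ 2 := fun i => by
      by_cases hi : b i ∈ Ioc (x j / 4) (x j / 2)
      · rw [indicator_of_mem hi]
        have h1 : ρ * x j < b i := by nlinarith [hi.1, hx0 j]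
        simp only [c, if_pos h1, Pi.one_apply, mul_one]
        have := hx0 j
        gcongr
        exact le_max_of_le_left (by linarith [hi.2])
      · rw [indicator_of_notMem hi, mul_zero]
        positivity
    have hsum : (x j / 2) ^ 2 * (k * x j / 8) ≤ ∑ i, c j i ^ 2 := by
      refine le_trans ?_ (Finset.sum_le_sum fun i _ => hterm i)
      rw [← Finset.mul_sum]
      exact mul_le_mul_of_nonneg_left (hb.le_count j j.2) (by positivity)
    rw [mul_pow, hT2]
    have h1 := mul_le_mul_of_nonneg_left hsum (by positivity : 0 ≤ e ^ 2 * (v : ℝ))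
    have h2 : 0 ≤ e ^ 2 * (v : ℝ) * (k * x j ^ 3) := by have := hx0 j; positivity
    nlinarith
  · have hterm : ∀ i, d j i ^ 2 ≤ x j ^ 2 * (Icc 0 (ρ * x j)).indicator (1 : ℝ → ℝ) (b i) :=
      fun i => by
        have hbi := hb.nonneg i
        by_cases hi : ρ * x j < b i
        · simp only [d, if_pos hi]
          rw [indicator_of_notMem fun h => hi.not_ge h.2]
          simp
        · rw [indicator_of_mem (show b i ∈ Icc 0 (ρ * x j) from ⟨hbi, not_lt.1 hi⟩)]
          simp only [d, if_neg hi, Pi.one_apply, mul_one]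
          gcongr
          exact max_le (by linarith) (hx0 j).le
    have hsum : ∑ i, d j i ^ 2 ≤ x j ^ 2 * (3 / 2 * (k * (ρ * x j))) := by
      refine (Finset.sum_le_sum fun i _ => hterm i).trans ?_
      rw [← Finset.mul_sum, ← hxs]
      exact mul_le_mul_of_nonneg_left (hb.count_le j j.2) (by positivity)
    rw [hT2]
    refine (mul_le_mul_of_nonneg_left hsum v.coe_nonneg).trans (le_of_eq ?_)
    field_simp
    ring

lemma rnnMeasure_not_hasPeriod3_le {k n : ℕ} (hk : 0 < k) {v : ℝ≥0} {ρ e : ℝ} (hρ : 0 < ρ)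
    (hρ4 : ρ ≤ 1 / 4) (he : 0 < e) (hscale : 144 ≤ e ^ 2 * (k * v * (ρ ^ n) ^ 3)) :
    rnnMeasure k v {x | HasPeriod3 (rnnStep x.1 x.2)}ᶜ
      ≤ ENNReal.ofReal (n * (2 / (k * (ρ ^ n) ^ 2)))
        + (ENNReal.ofReal (n * (2 / (k * (ρ ^ n) ^ 2)))
          + ENNReal.ofReal ((n + 1) * 2⁻¹ ^ n + n * e + n * (216 * ρ / e ^ 2))) := by
  set ν := Measure.pi (fun _ : Fin k => uniformUnit)
  set β := ENNReal.ofReal (n * (2 / (k * (ρ ^ n) ^ 2)))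
  set γ := ENNReal.ofReal ((n + 1) * 2⁻¹ ^ n + n * e + n * (216 * ρ / e ^ 2))
  have hβ : ν {b | ¬ WellSpread n ρ b} ≤ β := measure_not_wellSpread_le hk hρ hρ4
  have hsub : {x : (Fin k → ℝ) × (Fin k → ℝ) | HasPeriod3 (rnnStep x.1 x.2)}ᶜ ⊆
      univ ×ˢ {b | ¬ WellSpread n ρ b} ∪ {x | SignChange n ρ x.1 x.2}ᶜ := by
    intro x hx
    by_contra hcon
    simp only [mem_union, mem_prod, mem_univ, true_and, mem_ofPred_eq, mem_compl_iff, not_or,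
      not_not] at hcon
    exact hx (hcon.2.hasPeriod3 hρ (by linarith) hcon.1.nonneg)
  refine (measure_mono hsub).trans ((measure_union_le _ _).trans (add_le_add ?_ ?_))
  · rw [rnnMeasure, Measure.prod_prod, measure_univ, one_mul]
    exact hβ
  · rw [rnnMeasure, Measure.prod_apply_symm measurableSet_signChange.compl]
    set W := toMeasurable ν {b | ¬ WellSpread n ρ b}
    calc _ ≤ ∫⁻ b, W.indicator 1 b + γ ∂ν := by
          refine lintegral_mono fun b => ?_
          by_cases hb : WellSpread n ρ b
          · exact (weightMeasure_not_signChange_le hρ hρ4 he hscale hb).trans le_add_self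
          · rw [indicator_of_mem (subset_toMeasurable ν _ hb)]
            exact prob_le_one.trans le_self_add
      _ = ν W + γ := by
          rw [lintegral_add_right _ measurable_const,
            lintegral_indicator_one (measurableSet_toMeasurable _ _)]
          rw [lintegral_const, measure_univ, mul_one]
      _ ≤ β + γ := by
          rw [measure_toMeasurable]
          gcongr

lemma exists_scales {ε : ℝ} (hε : 0 < ε) :
    ∃ (n : ℕ) (e ρ : ℝ), 0 < e ∧ 0 < ρ ∧ ρ ≤ 1 / 4 ∧
      (n + 1) * 2⁻¹ ^ n + n * e + n * (216 * ρ / e ^ 2) ≤ ε := by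
  have h1 : Tendsto (fun n : ℕ => ((n : ℝ) + 1) * 2⁻¹ ^ n) atTop (nhds 0) := by
    have h := (tendsto_self_mul_const_pow_of_lt_one (r := (2⁻¹ : ℝ)) (by norm_num)
      (by norm_num)).add (tendsto_pow_atTop_nhds_zero_of_lt_one (r := (2⁻¹ : ℝ)) (by norm_num)
      (by norm_num))
    simpa [add_mul] using h
  obtain ⟨n, hn⟩ := (h1.eventually_lt_const (by positivity : 0 < ε / 3)).exists
  set e := ε / (3 * (n + 1)) with he_def
  have he : 0 < e := by positivity
  set r := e ^ 2 * ε / (648 * (n + 1)) with hr_def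
  have hr : 0 < r := by positivity
  refine ⟨n, e, min (1 / 4) r, he, by positivity, min_le_left _ _, ?_⟩
  have h2 : n * e ≤ ε / 3 := by
    rw [he_def, mul_div_assoc', div_le_div_iff₀ (by positivity) (by norm_num)]
    nlinarith
  have h3 : n * (216 * min (1 / 4) r / e ^ 2) ≤ ε / 3 := by
    calc n * (216 * min (1 / 4) r / e ^ 2) ≤ n * (216 * r / e ^ 2) := by
          gcongr
          exact min_le_right _ _
      _ = n * ε / (3 * (n + 1)) := by
          rw [hr_def]
          field_simp
          ring
      _ ≤ ε / 3 := by
          rw [div_le_div_iff₀ (by positivity) (by norm_num)]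
          nlinarith
  linarith

instance {k : ℕ} {v : ℝ≥0} : IsProbabilityMeasure (rnnMeasure k v) :=
  inferInstanceAs (IsProbabilityMeasure
    ((weightMeasure k v).prod (Measure.pi fun _ : Fin k => uniformUnit)))

/-- If `k * v k → ∞`, then with weights i.i.d. `N(0, v k)` and biases i.i.d.
`Uniform[0,1]`, the probability that the RNN step map has a point of period 3
tends to `1` as `k → ∞`. -/
theorem period_three_prob_tendsto_one (v : ℕ → ℝ) (hv : ∀ k, 0 < v k)
    (hlim : Tendsto (fun k : ℕ => (k : ℝ) * v k) atTop atTop) :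
    Tendsto (fun k : ℕ =>
        rnnMeasure k ((v k).toNNReal) {p | HasPeriod3 (rnnStep p.1 p.2)})
      atTop (nhds 1) := by
  have hcompl : Tendsto (fun k : ℕ => rnnMeasure k ((v k).toNNReal)
      {p | HasPeriod3 (rnnStep p.1 p.2)}ᶜ) atTop (nhds 0) := by
    rw [ENNReal.tendsto_nhds_zero]
    intro ε hε
    obtain ⟨r, hr0, hrε⟩ := ENNReal.lt_iff_exists_nnreal_btwn.1 hε
    have hr : (0 : ℝ) < r := by exact_mod_cast hr0
    obtain ⟨n, e, ρ, he, hρ, hρ4, hsmall⟩ := exists_scales (half_pos hr)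
    have hβ : Tendsto (fun k : ℕ => (n : ℝ) * (2 / (k * (ρ ^ n) ^ 2))) atTop (nhds 0) := by
      have h := (tendsto_natCast_atTop_atTop (R := ℝ)).atTop_mul_const
        (by positivity : 0 < (ρ ^ n) ^ 2)
      simpa using (h.const_div_atTop 2).const_mul (n : ℝ)
    filter_upwards [eventually_gt_atTop 0, hβ.eventually_lt_const (by positivity : 0 < (r : ℝ) / 4),
      hlim.eventually_ge_atTop (144 / (e ^ 2 * (ρ ^ n) ^ 3))] with k hk hk1 hk2
    have hscale : 144 ≤ e ^ 2 * (k * (v k).toNNReal * (ρ ^ n) ^ 3) := by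
      rw [Real.coe_toNNReal _ (hv k).le]
      rw [div_le_iff₀ (by positivity)] at hk2
      linarith
    refine (rnnMeasure_not_hasPeriod3_le hk hρ hρ4 he hscale).trans (le_trans ?_ hrε.le)
    rw [← ENNReal.ofReal_add (by positivity) (by positivity),
      ← ENNReal.ofReal_add (by positivity) (by positivity), ← ENNReal.ofReal_coe_nnreal]
    exact ENNReal.ofReal_le_ofReal (by linarith)
  have hlow : Tendsto (fun k : ℕ => 1 - rnnMeasure k ((v k).toNNReal)
      {p | HasPeriod3 (rnnStep p.1 p.2)}ᶜ) atTop (nhds 1) := by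
    simpa using ENNReal.Tendsto.sub tendsto_const_nhds hcompl (Or.inl ENNReal.one_ne_top)
  refine tendsto_of_tendsto_of_tendsto_of_le_of_le hlow tendsto_const_nhds (fun k => ?_)
    fun k => prob_le_one
  have h := measure_union_le (μ := rnnMeasure k ((v k).toNNReal))
    {p | HasPeriod3 (rnnStep p.1 p.2)} {p | HasPeriod3 (rnnStep p.1 p.2)}ᶜ
  rw [union_compl_self, measure_univ] at h
  exact tsub_le_iff_right.2 h
end
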